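/- arXiv:0902.3110 — 3 statements merged into one kernel-verified Lean document; each statement's English description precedes it below -/
import Mathlib

section
/- Let M be an S[T;f]-module, A ⊆ M an S[T;f]-submodule, and B ⊆ M the submodule with B/A = Nil(M/A). If M is Artinian over S (so Nil(M/A) is killed by a fixed power of T), then A* = B*, where N* = ⋂_{e≥0} S T^e N. -/
namespace HSL

/-- In an Artinian module with a least nonzero submodule (containing `u`), finitely generated
submodules are determined by their annihilators. -/
theorem dann {S E : Type*} [CommRing S] [AddCommGroup E] [Module S E] [IsArtinian S E]
    (u : E) (hu0 : u ≠ 0) (hu : ∀ W : Submodule S E, W ≠ ⊥ → u ∈ W)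
    (G : Submodule S E) : (∀ W ≤ G, W.FG) → ∀ e : E,
      (∀ s : S, (∀ g ∈ G, s • g = 0) → s • e = 0) → e ∈ G := by
  induction G using WellFoundedLT.induction with
  | ind G ih =>
  intro hG e he
  by_cases hbot : G = ⊥
  · have := he 1 (by subst hbot; simp)
    rw [one_smul] at this
    rw [this]; exact G.zero_mem
  have hu' : ∀ x : E, x ≠ 0 → ∃ a : S, a • x = u := by
    intro x hx
    have := hu (Submodule.span S {x}) (by simpa using hx)
    exact Submodule.mem_span_singleton.1 this
  -- a maximal proper submodule
  obtain ⟨G', hlt, g0, hg0, hg0', hmax⟩ : ∃ G' < G, ∃ g0 ∈ G, g0 ∉ G' ∧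
      ∀ g ∈ G, g ∉ G' → ∀ h ∈ G, ∃ t : S, h - t • g ∈ G' := by
    have : IsNoetherian S G := isNoetherian_submodule.2 hG
    have hne : (⊥ : Submodule S G) ≠ ⊤ := by
      intro h
      apply hbot
      rw [eq_bot_iff]
      intro x hx
      have : (⟨x, hx⟩ : G) ∈ (⊥ : Submodule S G) := by rw [h]; trivial
      simpa using this
    obtain ⟨Q, hQ, -⟩ := (eq_top_or_exists_le_coatom (⊥ : Submodule S G)).resolve_left hne
    have hQtop := hQ.1
    obtain ⟨x, hx⟩ : ∃ x : G, x ∉ Q := by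
      by_contra h
      push Not at h
      exact hQtop (eq_top_iff.2 fun x _ => h x)
    have hmem : ∀ y : G, (y : E) ∈ Q.map G.subtype ↔ y ∈ Q := by
      intro y
      simp
    refine ⟨Q.map G.subtype, lt_of_le_of_ne (Submodule.map_subtype_le _ _) ?_, x, x.2, ?_, ?_⟩
    · intro h
      exact hx ((hmem x).1 (h.ge x.2))
    · rw [hmem]; exact hx
    · intro g hg hgQ h hh
      have hgQ' : (⟨g, hg⟩ : G) ∉ Q := fun h' => hgQ ((hmem ⟨g, hg⟩).2 h')
      have htop : Q ⊔ Submodule.span S {(⟨g, hg⟩ : G)} = ⊤ := by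
        apply hQ.2
        refine lt_of_le_of_ne le_sup_left ?_
        intro h'
        apply hgQ'
        rw [h']
        exact Submodule.mem_sup_right (Submodule.mem_span_singleton_self _)
      have : (⟨h, hh⟩ : G) ∈ Q ⊔ Submodule.span S {(⟨g, hg⟩ : G)} := by rw [htop]; trivial
      obtain ⟨q, hq, z, hz, hqz⟩ := Submodule.mem_sup.1 this
      obtain ⟨t, rfl⟩ := Submodule.mem_span_singleton.1 hz
      refine ⟨t, ?_⟩
      have h2 : (q : E) = h - t • g := by
        have := congrArg (Subtype.val) hqz
        simp at this
        rw [← this]; simp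
      rw [← h2, hmem]; exact hq
  have hG' : ∀ W ≤ G', W.FG := fun W hW => hG W (hW.trans hlt.le)
  have IH := ih G' hlt hG'
  have hx : ∃ x : S, (∀ g ∈ G', x • g = 0) ∧ x • g0 ≠ 0 := by
    by_contra h
    push Not at h
    exact hg0' (IH g0 h)
  obtain ⟨x, hxG', hxg0⟩ := hx
  -- elements killing `G'` and moving `g0` into zero kill `G`
  have kill : ∀ s : S, (∀ g ∈ G', s • g = 0) → s • g0 = 0 → ∀ g ∈ G, s • g = 0 := by
    intro s hs hs0 g hg
    obtain ⟨t, ht⟩ := hmax g0 hg0 hg0' g hg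
    have := hs _ ht
    rw [smul_sub, smul_comm, hs0, smul_zero, sub_zero] at this
    exact this
  -- key : anything killed by all `r` with `r g0 ∈ G'` is a multiple of `x g0`
  have key : ∀ z : E, (∀ r : S, r • g0 ∈ G' → r • z = 0) → ∃ t : S, z = t • x • g0 := by
    intro z hz
    by_cases hz0 : z = 0
    · exact ⟨0, by simp [hz0]⟩
    obtain ⟨a, ha⟩ := hu' z hz0
    obtain ⟨b, hb⟩ := hu' _ hxg0
    have ha' : a • g0 ∉ G' := fun h => hu0 (by rw [← ha]; exact hz a h)
    obtain ⟨c, hc⟩ := hmax (a • g0) (G.smul_mem _ hg0) ha' g0 hg0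
    have h1 := hz (1 - c * a) (by rw [sub_smul, one_smul, mul_smul]; exact hc)
    rw [sub_smul, one_smul, mul_smul, sub_eq_zero, ha] at h1
    exact ⟨c * b, by rw [h1, mul_smul, hb]⟩
  obtain ⟨t, ht⟩ := key (x • e) (by
    intro r hr
    rw [← mul_smul]
    apply he
    apply kill
    · intro g hg; rw [mul_smul, hxG' g hg, smul_zero]
    · rw [mul_comm, mul_smul]; exact hxG' _ hr)
  have he' : e - t • g0 ∈ G' := by
    apply IH
    intro s hs
    obtain ⟨t', ht'⟩ := key (s • g0) (by
      intro r hr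
      rw [smul_comm]; exact hs _ hr)
    have h1 := he (s - t' * x) (kill _ (by
      intro g hg; rw [sub_smul, mul_smul, hs g hg, hxG' g hg]; simp) (by
      rw [sub_smul, mul_smul, ← ht', sub_self]))
    rw [sub_smul, mul_smul, sub_eq_zero] at h1
    rw [smul_sub, h1, ht, smul_comm s t, ht', sub_eq_zero, smul_comm t t']
  have := G.add_mem (hlt.le he') (G.smul_mem t hg0)
  simpa using this

/-- affine subsets of the ring -/
def Aff {S : Type*} [CommRing S] (X : Set S) : Prop :=
  ∀ x ∈ X, ∀ y ∈ X, ∀ z ∈ X, ∀ r : S, x + r * (y - z) ∈ X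

/-- subsets open for the topology of pointwise convergence on `D` -/
def Opn {S : Type*} (D : Type*) [CommRing S] [AddCommGroup D] [Module S D] (X : Set S) : Prop :=
  ∃ F : Set D, F.Finite ∧ ∀ x ∈ X, ∀ t : S, (∀ d ∈ F, t • d = x • d) → t ∈ X

/-- linear compactness of `S` with respect to `D` -/
def LC (S D : Type*) [CommRing S] [AddCommGroup D] [Module S D] : Prop :=
  ∀ 𝓕 : Set (Set S), (∀ X ∈ 𝓕, Aff X ∧ Opn D X) →
    (∀ 𝓖 : Set (Set S), 𝓖 ⊆ 𝓕 → 𝓖.Finite → ∃ s, ∀ X ∈ 𝓖, s ∈ X) → ∃ s, ∀ X ∈ 𝓕, s ∈ X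

theorem LC.of_map {S D D' : Type*} [CommRing S] [AddCommGroup D] [Module S D]
    [AddCommGroup D'] [Module S D'] (h : LC S D)
    (H : ∀ d' : D', ∃ d : D, ∀ s t : S, s • d = t • d → s • d' = t • d') : LC S D' := by
  intro 𝓕 h1 h2
  refine h 𝓕 (fun X hX => ⟨(h1 X hX).1, ?_⟩) h2
  obtain ⟨F, hF, hF'⟩ := (h1 X hX).2
  choose l hl using H
  refine ⟨l '' F, hF.image _, fun x hx t ht => hF' x hx t fun d hd => ?_⟩
  exact hl d _ _ (ht _ ⟨d, hd, rfl⟩)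

theorem LC.quot {S D : Type*} [CommRing S] [AddCommGroup D] [Module S D] (h : LC S D)
    (Q : Submodule S D) : LC S (D ⧸ Q) := by
  refine h.of_map fun d' => ?_
  obtain ⟨d, rfl⟩ := Q.mkQ_surjective d'
  exact ⟨d, fun s t h => by rw [← map_smul, h, map_smul]⟩

theorem LC.sub {S D : Type*} [CommRing S] [AddCommGroup D] [Module S D] (h : LC S D)
    (Q : Submodule S D) : LC S Q :=
  h.of_map fun d' => ⟨d', fun s t h => Subtype.ext (by simpa using h)⟩

theorem bounded {S E : Type*} [CommRing S] [AddCommGroup E] [Module S E] [IsArtinian S E]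
    (hLC : LC S E) (u : E) (hu0 : u ≠ 0) (hu : ∀ W : Submodule S E, W ≠ ⊥ → u ∈ W)
    (V : Submodule S E) (hV : V ≠ ⊤) : ∃ s : S, (∀ v ∈ V, s • v = 0) ∧ ∃ e : E, s • e ≠ 0 := by
  obtain ⟨e, he⟩ : ∃ e, e ∉ V := by
    by_contra h
    push Not at h
    exact hV (eq_top_iff.2 fun x _ => h x)
  let X0 : Set S := {t | t • e = u}
  let f : E → Set S := fun v => {t | t • v = 0}
  obtain ⟨s, hs⟩ := hLC (insert X0 (f '' V)) (by
    rintro X (rfl | ⟨v, -, rfl⟩)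
    · refine ⟨?_, {e}, Set.finite_singleton _, ?_⟩
      · intro x hx y hy z hz r
        simp only [X0, Set.mem_ofPred_eq] at *
        rw [add_smul, mul_smul, sub_smul, hx, hy, hz]; simp
      · intro x hx t ht
        simp only [X0, Set.mem_ofPred_eq] at *
        rw [ht e rfl, hx]
    · refine ⟨?_, {v}, Set.finite_singleton _, ?_⟩
      · intro x hx y hy z hz r
        simp only [f, Set.mem_ofPred_eq] at *
        rw [add_smul, mul_smul, sub_smul, hx, hy, hz]; simp
      · intro x hx t ht
        simp only [f, Set.mem_ofPred_eq] at *
        rw [ht v rfl, hx]) (by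
    intro 𝓖 h𝓖 hfin
    have : ∀ X ∈ 𝓖, ∃ v ∈ V, X = X0 ∨ X = f v := by
      intro X hX
      rcases h𝓖 hX with rfl | ⟨v, hv, rfl⟩
      · exact ⟨0, V.zero_mem, Or.inl rfl⟩
      · exact ⟨v, hv, Or.inr rfl⟩
    choose! v hvV hv using this
    let G := Submodule.span S (v '' 𝓖)
    have hGV : G ≤ V := by
      rw [Submodule.span_le]
      rintro _ ⟨X, hX, rfl⟩
      exact hvV X hX
    have hfg : G.FG := Submodule.fg_span (hfin.image _)
    have : Module.Finite S G := Module.Finite.iff_fg.2 hfg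
    have : IsNoetherian S G := isNoetherian_of_finite_isArtinian _
    have h1 : ∃ s : S, (∀ g ∈ G, s • g = 0) ∧ s • e ≠ 0 := by
      by_contra h
      push Not at h
      exact he (hGV (dann u hu0 hu G (isNoetherian_submodule.1 this) e h))
    obtain ⟨s, hs, hse⟩ := h1
    have h2 := hu (Submodule.span S {s • e}) (by simpa using hse)
    obtain ⟨a, ha⟩ := Submodule.mem_span_singleton.1 h2
    refine ⟨a * s, fun X hX => ?_⟩
    rcases hv X hX with h | h
    · rw [h]; simp only [X0, Set.mem_ofPred_eq]; rw [mul_smul, ha]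
    · rw [h]; simp only [f, Set.mem_ofPred_eq]
      rw [mul_smul, hs _ (Submodule.subset_span ⟨X, hX, rfl⟩), smul_zero])
  refine ⟨s, fun v hv => hs (f v) (Or.inr ⟨v, hv, rfl⟩), e, ?_⟩
  have : s • e = u := hs X0 (Or.inl rfl)
  rw [this]; exact hu0

/-- `C` is maximal among submodules avoiding some element -/
def Irr {S D : Type*} [CommRing S] [AddCommGroup D] [Module S D] (C : Submodule S D) : Prop :=
  ∃ d, d ∉ C ∧ ∀ W : Submodule S D, C < W → d ∈ W

theorem exists_irr {S D : Type*} [CommRing S] [AddCommGroup D] [Module S D] (d : D) (hd : d ≠ 0) :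
    ∃ C : Submodule S D, Irr C ∧ d ∉ C := by
  obtain ⟨C, -, hC⟩ := zorn_le_nonempty₀ {C : Submodule S D | d ∉ C} (by
    intro c hc hchain y hy
    refine ⟨sSup c, ?_, fun z hz => le_sSup hz⟩
    intro h
    obtain ⟨y, hy, h⟩ := (Submodule.mem_sSup_of_directed ⟨y, hy⟩ hchain.directedOn).1 h
    exact hc hy h) ⊥ (by simpa using hd)
  refine ⟨C, ⟨d, hC.prop, fun W hW => ?_⟩, hC.prop⟩
  by_contra h
  exact hW.not_ge (hC.le_of_ge h hW.le)

theorem irr_decomp {S D : Type*} [CommRing S] [AddCommGroup D] [Module S D] [IsArtinian S D] :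
    ∃ l : List (Submodule S D), (∀ C ∈ l, Irr C) ∧ l.foldr (· ⊓ ·) ⊤ = ⊥ := by
  obtain ⟨N, ⟨l, hl, rfl⟩, hmin⟩ := IsArtinian.set_has_minimal
    {N : Submodule S D | ∃ l : List (Submodule S D), (∀ C ∈ l, Irr C) ∧ l.foldr (· ⊓ ·) ⊤ = N}
    ⟨⊤, [], by simp, rfl⟩
  refine ⟨l, hl, ?_⟩
  by_contra h
  obtain ⟨d, hd, hd0⟩ := Submodule.exists_mem_ne_zero_of_ne_bot h
  obtain ⟨C, hC, hdC⟩ := exists_irr (S := S) d hd0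
  refine hmin (C ⊓ l.foldr (· ⊓ ·) ⊤) ⟨C :: l, ?_, rfl⟩ ?_
  · intro C' hC'
    rcases List.mem_cons.1 hC' with rfl | h
    · exact hC
    · exact hl _ h
  · refine lt_of_le_of_ne inf_le_right fun h => ?_
    rw [← h] at hd
    exact hdC hd.1

theorem bounded' {S D : Type*} [CommRing S] [AddCommGroup D] [Module S D] [IsArtinian S D]
    (hLC : LC S D) (C : Submodule S D) (hC : Irr C) (V : Submodule S D) (hV : V ⊔ C ≠ ⊤) :
    ∃ s : S, (∀ v ∈ V, s • v ∈ C) ∧ ∃ e : D, s • e ∉ C := by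
  obtain ⟨d, hd, hC⟩ := hC
  obtain ⟨s, h1, e, he⟩ := bounded (hLC.quot C) (C.mkQ d) (by simpa using hd) (by
    intro W hW
    have : C < W.comap C.mkQ := by
      refine lt_of_le_of_ne ?_ ?_
      · intro x hx
        have : C.mkQ x = 0 := by simpa using hx
        rw [Submodule.mem_comap, this]; exact W.zero_mem
      · intro h
        apply hW
        rw [eq_bot_iff]
        intro x hx
        obtain ⟨x, rfl⟩ := C.mkQ_surjective x
        have : x ∈ C := by rw [h]; exact hx
        simpa using this
    exact hC _ this) (V.map C.mkQ) (by
    intro h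
    apply hV
    have := congrArg (Submodule.comap C.mkQ) h
    rw [Submodule.comap_map_mkQ, Submodule.comap_top] at this
    rwa [sup_comm])
  refine ⟨s, fun v hv => ?_, ?_⟩
  · have := h1 _ (Submodule.mem_map_of_mem hv)
    rw [← map_smul] at this
    exact (Submodule.Quotient.mk_eq_zero C).1 this
  · obtain ⟨e, rfl⟩ := C.mkQ_surjective e
    refine ⟨e, fun h => he ?_⟩
    rw [← map_smul]
    exact (Submodule.Quotient.mk_eq_zero C).2 h

theorem chain {S D : Type*} [CommRing S] [AddCommGroup D] [Module S D] [IsArtinian S D]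
    (hLC : LC S D)
    (hdich : ∀ x : S, (∀ d : D, x • d = 0) ∨ (∀ d : D, ∃ d' : D, x • d' = d))
    (K : ℕ → Submodule S D) (hK : Monotone K) (l : List (Submodule S D)) (hl : ∀ C ∈ l, Irr C) :
    ∃ j0, ∀ j ≥ j0, ∃ s : S, (∀ d : D, ∃ d' : D, s • d' = d) ∧
      ∀ v ∈ K (j + 1), s • v ∈ K j ⊔ l.foldr (· ⊓ ·) ⊤ := by
  induction l with
  | nil => exact ⟨0, fun j _ => ⟨1, fun d => ⟨d, one_smul _ _⟩, fun v _ => by simp⟩⟩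
  | cons C l ih =>
    obtain ⟨j0, hj0⟩ := ih (fun C' h => hl C' (List.mem_cons_of_mem _ h))
    have hC := hl C List.mem_cons_self
    simp only [List.foldr_cons]
    set G := l.foldr (· ⊓ ·) ⊤ with hG
    by_cases hfull : ∃ j1, (K j1 ⊓ G) ⊔ C = ⊤
    · obtain ⟨j1, hj1⟩ := hfull
      refine ⟨max j0 j1, fun j hj => ?_⟩
      obtain ⟨s, hs, hsv⟩ := hj0 j (le_trans (le_max_left _ _) hj)
      refine ⟨s, hs, fun v hv => ?_⟩
      obtain ⟨k, hk, g, hg, hkg⟩ := Submodule.mem_sup.1 (hsv v hv)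
      have : g ∈ (K j1 ⊓ G) ⊔ C := by rw [hj1]; trivial
      obtain ⟨k', hk', c, hc, rfl⟩ := Submodule.mem_sup.1 this
      have hcG : c ∈ G := by
        have := G.sub_mem hg hk'.2
        simpa using this
      rw [← hkg, ← add_assoc]
      exact Submodule.add_mem_sup ((K j).add_mem hk
        (hK (le_trans (le_max_right _ _) hj) hk'.1)) ⟨hc, hcG⟩
    · push Not at hfull
      refine ⟨j0, fun j hj => ?_⟩
      obtain ⟨s, hs, hsv⟩ := hj0 j hj
      obtain ⟨t, ht, e, he⟩ := bounded' hLC C hC _ (hfull (j + 1))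
      have ht' : ∀ d : D, ∃ d' : D, t • d' = d := by
        refine (hdich t).resolve_left fun h => he ?_
        rw [h]; exact C.zero_mem
      refine ⟨t * s, fun d => ?_, fun v hv => ?_⟩
      · obtain ⟨d1, rfl⟩ := ht' d
        obtain ⟨d2, rfl⟩ := hs d1
        exact ⟨d2, mul_smul _ _ _⟩
      · obtain ⟨k, hk, g, hg, hkg⟩ := Submodule.mem_sup.1 (hsv v hv)
        have hgK : g ∈ K (j + 1) := by
          have : g = s • v - k := by rw [← hkg]; simp
          rw [this]
          exact (K (j + 1)).sub_mem ((K (j + 1)).smul_mem _ hv) (hK (Nat.le_succ j) hk)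
        rw [mul_smul, ← hkg, smul_add]
        exact Submodule.add_mem_sup ((K j).smul_mem _ hk) ⟨ht _ ⟨hgK, hg⟩, G.smul_mem _ hg⟩

theorem iter_smul {S D : Type*} [CommRing S] [AddCommGroup D] [Module S D]
    (p : ℕ) (θ : D →+ D) (hθ : ∀ (s : S) (m : D), θ (s • m) = s ^ p • θ m) (j : ℕ) (s : S) (m : D) :
    (⇑θ)^[j] (s • m) = s ^ (p ^ j) • (⇑θ)^[j] m := by
  induction j generalizing m s with
  | zero => simp
  | succ j ih => rw [Function.iterate_succ_apply, Function.iterate_succ_apply, hθ, ih, ← pow_mul,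
      pow_succ']

/-- kernel of the `j`-th iterate -/
def Ker {S D : Type*} [CommRing S] [AddCommGroup D] [Module S D]
    (p : ℕ) (θ : D →+ D) (hθ : ∀ (s : S) (m : D), θ (s • m) = s ^ p • θ m) (j : ℕ) :
    Submodule S D where
  carrier := {d | (⇑θ)^[j] d = 0}
  zero_mem' := iterate_map_zero θ j
  add_mem' := by
    intro a b ha hb
    simp only [Set.mem_ofPred_eq] at *
    rw [iterate_map_add, ha, hb, add_zero]
  smul_mem' := by
    intro s a ha
    simp only [Set.mem_ofPred_eq] at *
    rw [iter_smul p θ hθ, ha, smul_zero]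

theorem core {S D : Type*} [CommRing S] [AddCommGroup D] [Module S D] [IsArtinian S D]
    (hLC : LC S D)
    (hdich : ∀ x : S, (∀ d : D, x • d = 0) ∨ (∀ d : D, ∃ d' : D, x • d' = d))
    (p : ℕ) (hp : 2 ≤ p) (θ : D →+ D) (hθ : ∀ (s : S) (m : D), θ (s • m) = s ^ p • θ m)
    (hnil : ∀ d, ∃ j : ℕ, (⇑θ)^[j] d = 0) : ∃ j : ℕ, ∀ d, (⇑θ)^[j] d = 0 := by
  let K := Ker p θ hθ
  have memK : ∀ j d, d ∈ K j ↔ (⇑θ)^[j] d = 0 := fun j d => Iff.rfl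
  have memK' : ∀ j d, d ∈ K (j + 1) ↔ θ d ∈ K j := fun j d => Iff.rfl
  have hK : Monotone K := by
    apply monotone_nat_of_le_succ
    intro j d hd
    rw [memK] at *
    rw [Function.iterate_succ_apply', hd, map_zero]
  obtain ⟨l, hl, hl0⟩ := irr_decomp (S := S) (D := D)
  obtain ⟨j0, hj0⟩ := chain hLC hdich K hK l hl
  obtain ⟨s, hs, hsv⟩ := hj0 j0 le_rfl
  rw [hl0, sup_bot_eq] at hsv
  have main : ∀ i, ∀ y ∈ K (j0 + i), s ^ 2 • y ∈ K j0 := by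
    intro i
    induction i with
    | zero => exact fun y hy => (K j0).smul_mem _ hy
    | succ i ih =>
      intro y hy
      have h1 : θ y ∈ K (j0 + i) := hy
      have h2 : s • y ∈ K (j0 + 1) := by
        rw [memK', hθ]
        obtain ⟨q, rfl⟩ := Nat.exists_eq_add_of_le' hp
        rw [pow_add, mul_smul]
        exact (K j0).smul_mem _ (ih _ h1)
      rw [pow_two, mul_smul]
      exact hsv _ h2
  refine ⟨j0, fun d => ?_⟩
  obtain ⟨d1, rfl⟩ := hs d
  obtain ⟨d2, rfl⟩ := hs d1
  obtain ⟨i, hi⟩ := hnil d2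
  have := main i d2 (hK (Nat.le_add_left _ _) ((memK _ _).2 hi))
  rw [pow_two, mul_smul] at this
  exact this

theorem nilp {S D : Type*} [CommRing S] [AddCommGroup D] [Module S D] [IsArtinian S D]
    (P : Ideal S) (hP : P = (Module.annihilator S D).radical) :
    ∃ N : ℕ, ∀ b ∈ P ^ N, ∀ d : D, b • d = 0 := by
  let T : Ideal S → Submodule S D := fun I =>
    { carrier := {d : D | ∀ a ∈ I, a • d = 0}
      zero_mem' := fun a _ => smul_zero a
      add_mem' := fun {x y : D} hx hy a ha => by rw [smul_add, hx a ha, hy a ha, add_zero]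
      smul_mem' := fun c x hx a ha => by rw [smul_comm, hx a ha, smul_zero] }
  have memT : ∀ I d, d ∈ T I ↔ ∀ a ∈ I, a • d = 0 := fun I d => Iff.rfl
  obtain ⟨_, ⟨I, hI, hIP, rfl⟩, hmin⟩ := IsArtinian.set_has_minimal
    {N : Submodule S D | ∃ I : Ideal S, I.FG ∧ I ≤ P ∧ N = T I}
    ⟨T ⊥, ⊥, Submodule.fg_bot, bot_le, rfl⟩
  have hTP : ∀ d : D, (∀ a ∈ I, a • d = 0) → ∀ b ∈ P, b • d = 0 := by
    intro d hd b hb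
    have h1 : T (I ⊔ Ideal.span {b}) ≤ T I := fun x hx a ha => hx a (Ideal.mem_sup_left ha)
    have h2 : T (I ⊔ Ideal.span {b}) = T I := by
      by_contra h
      refine hmin _ ⟨I ⊔ Ideal.span {b}, Submodule.FG.sup hI (Submodule.fg_span_singleton b), ?_, rfl⟩
        (lt_of_le_of_ne h1 h)
      refine sup_le hIP ?_
      rw [Ideal.span_le]
      simpa using hb
    have h3 : d ∈ T (I ⊔ Ideal.span {b}) := by rw [h2]; exact hd
    exact h3 b (Ideal.mem_sup_right (Ideal.mem_span_singleton_self b))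
  obtain ⟨N, hN⟩ := Ideal.exists_pow_le_of_le_radical_of_fg (hP ▸ hIP) hI
  have key : ∀ k, ∀ d : D, (∀ a ∈ I ^ k, a • d = 0) → ∀ b ∈ P ^ k, b • d = 0 := by
    intro k
    induction k with
    | zero =>
      intro d hd b _
      have := hd 1 (by simp)
      rw [one_smul] at this
      rw [this, smul_zero]
    | succ k ih =>
      intro d hd b hb
      rw [pow_succ] at hb
      refine Submodule.mul_induction_on hb ?_ ?_
      · intro m hm n hn
        rw [mul_comm, mul_smul]
        refine hTP _ ?_ n hn
        intro a ha
        rw [smul_comm]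
        refine ih (a • d) ?_ m hm
        intro c hc
        rw [← mul_smul]
        apply hd
        rw [pow_succ]
        exact Ideal.mul_mem_mul hc ha
      · intro x y hx hy
        rw [add_smul, hx, hy, add_zero]
  refine ⟨N, fun b hb d => key N d (fun a ha => ?_) b hb⟩
  exact Module.mem_annihilator.1 (hN ha) d

theorem red {S D : Type*} [CommRing S] [AddCommGroup D] [Module S D] [IsArtinian S D]
    (hLC : LC S D)
    (p : ℕ) (hp : 2 ≤ p) (θ : D →+ D) (hθ : ∀ (s : S) (m : D), θ (s • m) = s ^ p • θ m)
    (hnil : ∀ d, ∃ j : ℕ, (⇑θ)^[j] d = 0)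
    (hmin : ∀ W : Submodule S D, (∀ w ∈ W, θ w ∈ W) → W ≠ ⊤ → ∃ j : ℕ, ∀ w ∈ W, (⇑θ)^[j] w = 0) :
    ∃ j : ℕ, ∀ d, (⇑θ)^[j] d = 0 := by
  by_contra hne
  have hspan : ∀ e, Submodule.span S (Set.range (⇑θ)^[e]) = ⊤ := by
    intro e
    by_contra h
    obtain ⟨j, hj⟩ := hmin _ (by
      intro w hw
      induction hw using Submodule.span_induction with
      | mem x hx =>
        obtain ⟨y, rfl⟩ := hx
        apply Submodule.subset_span
        exact ⟨θ y, by rw [← Function.iterate_succ_apply, Function.iterate_succ_apply']⟩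
      | zero => rw [map_zero]; exact Submodule.zero_mem _
      | add x y _ _ hx hy => rw [map_add]; exact Submodule.add_mem _ hx hy
      | smul a x _ hx => rw [hθ]; exact Submodule.smul_mem _ _ hx) h
    refine hne ⟨j + e, fun d => ?_⟩
    rw [Function.iterate_add_apply]
    exact hj _ (Submodule.subset_span ⟨d, rfl⟩)
  have hdich : ∀ x : S, (∃ n : ℕ, ∀ d : D, x ^ n • d = 0) ∨ (∀ d : D, ∃ d' : D, x • d' = d) := by
    intro x
    by_cases h : LinearMap.range (LinearMap.lsmul S D x) = ⊤
    · right
      intro d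
      have : d ∈ LinearMap.range (LinearMap.lsmul S D x) := by rw [h]; trivial
      obtain ⟨d', hd'⟩ := this
      exact ⟨d', hd'⟩
    · left
      obtain ⟨j, hj⟩ := hmin _ (by
        rintro _ ⟨d, rfl⟩
        refine ⟨x ^ (p - 1) • θ d, ?_⟩
        simp only [LinearMap.lsmul_apply]
        rw [hθ, ← mul_smul, ← pow_succ']
        congr 2
        omega) h
      refine ⟨p ^ j, fun d => ?_⟩
      have hd : d ∈ Submodule.span S (Set.range (⇑θ)^[j]) := by rw [hspan]; trivial
      induction hd using Submodule.span_induction with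
      | mem y hy =>
        obtain ⟨z, rfl⟩ := hy
        rw [← iter_smul p θ hθ]
        exact hj _ ⟨z, rfl⟩
      | zero => rw [smul_zero]
      | add y z _ _ hy hz => rw [smul_add, hy, hz, add_zero]
      | smul a y _ hy => rw [smul_comm, hy, smul_zero]
  let P := (Module.annihilator S D).radical
  let Q : Submodule S D := P • ⊤
  have hQ : Q ≠ ⊤ := by
    intro hQ
    obtain ⟨N, hN⟩ := nilp (S := S) (D := D) P rfl
    have h1 : ∀ k, (P ^ k) • (⊤ : Submodule S D) = ⊤ := by
      intro k
      induction k with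
      | zero => simp
      | succ k ih => rw [pow_succ, Submodule.mul_smul]; change P ^ k • Q = ⊤; rw [hQ, ih]
    apply hne
    refine ⟨0, fun d => ?_⟩
    have hd : d ∈ (P ^ N) • (⊤ : Submodule S D) := by rw [h1]; trivial
    have h2 : (P ^ N) • (⊤ : Submodule S D) ≤ ⊥ := by
      rw [Submodule.smul_le]
      intro r hr n _
      simpa using hN r hr n
    simpa using h2 hd
  have hQst : ∀ w ∈ Q, θ w ∈ Q := by
    intro w hw
    refine Submodule.smul_induction_on hw ?_ ?_
    · intro r hr n _
      rw [hθ]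
      exact Submodule.smul_mem_smul (Ideal.pow_mem_of_mem _ hr _ (by omega)) trivial
    · intro x y hx hy
      rw [map_add]; exact Q.add_mem hx hy
  obtain ⟨i, hi⟩ := hmin Q hQst hQ
  let θ' : D ⧸ Q →+ D ⧸ Q := QuotientAddGroup.map Q.toAddSubgroup Q.toAddSubgroup θ hQst
  have hθ' : ∀ d, θ' (Q.mkQ d) = Q.mkQ (θ d) := fun d => rfl
  have hit : ∀ j d, (⇑θ')^[j] (Q.mkQ d) = Q.mkQ ((⇑θ)^[j] d) := by
    intro j
    induction j with
    | zero => intro d; rfl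
    | succ j ih => intro d; rw [Function.iterate_succ_apply, Function.iterate_succ_apply, hθ', ih]
  obtain ⟨j, hj⟩ := core (hLC.quot Q) (by
    intro x
    rcases hdich x with ⟨n, hn⟩ | h
    · left
      intro d
      obtain ⟨d, rfl⟩ := Q.mkQ_surjective d
      rw [← map_smul]
      refine (Submodule.Quotient.mk_eq_zero Q).2 (Submodule.smul_mem_smul ?_ trivial)
      exact ⟨n, Module.mem_annihilator.2 hn⟩
    · right
      intro d
      obtain ⟨d, rfl⟩ := Q.mkQ_surjective d
      obtain ⟨d', rfl⟩ := h d
      exact ⟨Q.mkQ d', by rw [map_smul]⟩) p hp θ' (by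
    intro s m
    obtain ⟨m, rfl⟩ := Q.mkQ_surjective m
    rw [← map_smul, hθ', hθ', hθ, map_smul]) (by
    intro d
    obtain ⟨d, rfl⟩ := Q.mkQ_surjective d
    obtain ⟨j, hj⟩ := hnil d
    exact ⟨j, by rw [hit, hj, map_zero]⟩)
  refine hne ⟨i + j, fun d => ?_⟩
  rw [Function.iterate_add_apply]
  apply hi
  have := hj (Q.mkQ d)
  rw [hit] at this
  exact (Submodule.Quotient.mk_eq_zero Q).1 this

theorem hsl_LC {S D : Type*} [CommRing S] [AddCommGroup D] [Module S D] [IsArtinian S D]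
    (hLC : LC S D)
    (p : ℕ) (hp : 2 ≤ p) (θ : D →+ D) (hθ : ∀ (s : S) (m : D), θ (s • m) = s ^ p • θ m)
    (hnil : ∀ d, ∃ j : ℕ, (⇑θ)^[j] d = 0) : ∃ j : ℕ, ∀ d, (⇑θ)^[j] d = 0 := by
  by_contra hne
  obtain ⟨W, ⟨hWst, hWne⟩, hmin⟩ := IsArtinian.set_has_minimal
    {W : Submodule S D | (∀ w ∈ W, θ w ∈ W) ∧ ¬ ∃ j : ℕ, ∀ w ∈ W, (⇑θ)^[j] w = 0}
    ⟨⊤, fun _ _ => trivial, fun ⟨j, hj⟩ => hne ⟨j, fun d => hj d trivial⟩⟩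
  let θ' : W →+ W := (θ.comp W.subtype.toAddMonoidHom).codRestrict W (fun w => hWst w w.2)
  have hθ' : ∀ w, ((θ' w : W) : D) = θ w := fun w => rfl
  have hit : ∀ j, ∀ w : W, (((⇑θ')^[j] w : W) : D) = (⇑θ)^[j] w := by
    intro j
    induction j with
    | zero => intro w; rfl
    | succ j ih => intro w; rw [Function.iterate_succ_apply, Function.iterate_succ_apply, ih, hθ']
  obtain ⟨j, hj⟩ := red (hLC.sub W) p hp θ' (by
    intro s m
    apply Subtype.ext
    rw [hθ', W.coe_smul, hθ, W.coe_smul, hθ']) (by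
    intro d
    obtain ⟨j, hj⟩ := hnil d
    exact ⟨j, Subtype.ext (by rw [hit, hj]; rfl)⟩) (by
    intro V hV hVtop
    by_contra h
    refine hmin (V.map W.subtype) ⟨?_, ?_⟩ ?_
    · rintro _ ⟨v, hv, rfl⟩
      exact ⟨θ' v, hV v hv, rfl⟩
    · rintro ⟨j, hj⟩
      refine h ⟨j, fun w hw => Subtype.ext ?_⟩
      rw [hit]
      exact hj _ ⟨w, hw, rfl⟩
    · refine lt_of_le_of_ne (Submodule.map_subtype_le _ _) fun h => hVtop ?_
      rw [eq_top_iff]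
      intro x _
      obtain ⟨y, hy, hyx⟩ := h.ge x.2
      rwa [← Subtype.ext hyx])
  refine hWne ⟨j, fun w hw => ?_⟩
  have := congrArg Subtype.val (hj ⟨w, hw⟩)
  rw [hit] at this
  exact this

/-- If `S` contains every map which is locally given by an element of `S`, then `S` is linearly
compact with respect to an Artinian module. -/
theorem LC_of_closed {S D : Type*} [CommRing S] [AddCommGroup D] [Module S D] [IsArtinian S D]
    (hcl : ∀ f : D → D, (∀ F : Set D, F.Finite → ∃ s : S, ∀ d ∈ F, f d = s • d) →
      ∃ s : S, ∀ d, f d = s • d) : LC S D := by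
  intro 𝓕 h𝓕 hfip
  obtain ⟨𝓜, hsub, hmax⟩ := zorn_subset_nonempty
    {𝓜 : Set (Set S) | (∀ X ∈ 𝓜, Aff X) ∧
      ∀ 𝓖 : Set (Set S), 𝓖 ⊆ 𝓜 → 𝓖.Finite → ∃ s, ∀ X ∈ 𝓖, s ∈ X} (by
    intro c hc hchain hcne
    refine ⟨⋃₀ c, ⟨?_, ?_⟩, fun s hs => Set.subset_sUnion_of_mem hs⟩
    · rintro X ⟨m, hm, hX⟩
      exact (hc hm).1 X hX
    · intro 𝓖 h𝓖 hfin
      obtain ⟨m, hm, hGm⟩ := DirectedOn.exists_mem_subset_of_finite_of_subset_sUnion hcne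
        hchain.directedOn hfin h𝓖
      exact (hc hm).2 𝓖 hGm hfin) 𝓕 ⟨fun X hX => (h𝓕 X hX).1, hfip⟩
  obtain ⟨hAff, hFIP⟩ := hmax.prop
  -- evaluation at each `d` is decided by `𝓜`
  have dec : ∀ d : D, ∃ y : D, {t : S | t • d = y} ∈ 𝓜 := by
    intro d
    -- minimal image
    obtain ⟨N, ⟨𝓖, h𝓖, hfin, x, hx, hN⟩, hmin⟩ := IsArtinian.set_has_minimal
      {N : Submodule S D | ∃ 𝓖 : Set (Set S), 𝓖 ⊆ 𝓜 ∧ 𝓖.Finite ∧ ∃ x, (∀ X ∈ 𝓖, x ∈ X) ∧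
        ∀ n, n ∈ N ↔ ∃ w : S, (∀ X ∈ 𝓖, x + w ∈ X) ∧ w • d = n}
      ⟨LinearMap.range (LinearMap.toSpanSingleton S D d), ∅, by simp, Set.finite_empty, 0, by simp,
        fun n => by simp⟩
    refine ⟨x • d, ?_⟩
    have hmem : insert {t : S | t • d = x • d} 𝓜 ∈ {𝓜 : Set (Set S) | (∀ X ∈ 𝓜, Aff X) ∧
      ∀ 𝓖 : Set (Set S), 𝓖 ⊆ 𝓜 → 𝓖.Finite → ∃ s, ∀ X ∈ 𝓖, s ∈ X} := by
      refine ⟨?_, ?_⟩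
      · rintro X (rfl | hX)
        · intro x hx y hy z hz r
          simp only [Set.mem_ofPred_eq] at *
          rw [add_smul, mul_smul, sub_smul, hx, hy, hz]; simp
        · exact hAff X hX
      · intro 𝓗 h𝓗 hHfin
        set 𝓗' := 𝓗 ∩ 𝓜 with h𝓗'
        have hU : 𝓖 ∪ 𝓗' ⊆ 𝓜 := Set.union_subset h𝓖 Set.inter_subset_right
        have hUfin : (𝓖 ∪ 𝓗').Finite := hfin.union (hHfin.subset Set.inter_subset_left)
        obtain ⟨y, hy⟩ := hFIP _ hU hUfin
        let a : Ideal S :=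
          { carrier := {w | ∀ X ∈ 𝓖 ∪ 𝓗', y + w ∈ X}
            zero_mem' := by intro X hX; rw [add_zero]; exact hy X hX
            add_mem' := by
              intro w1 w2 h1 h2 X hX
              have := hAff X (hU hX) _ (h1 X hX) _ (h2 X hX) _ (hy X hX) 1
              convert this using 1
              ring
            smul_mem' := by
              intro r w h1 X hX
              have := hAff X (hU hX) _ (hy X hX) _ (h1 X hX) _ (hy X hX) r
              convert this using 1
              simp }
        let N' : Submodule S D := Submodule.map (LinearMap.toSpanSingleton S D d) a
        have hN' : ∀ n, n ∈ N' ↔ ∃ w : S, (∀ X ∈ 𝓖 ∪ 𝓗', y + w ∈ X) ∧ w • d = n := fun n => Iff.rfl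
        have hle : N' ≤ N := by
          intro n hn
          obtain ⟨w, hw, rfl⟩ := (hN' n).1 hn
          refine (hN _).2 ⟨w, fun X hX => ?_, rfl⟩
          have := hAff X (h𝓖 hX) _ (hx X hX) _ (hw X (Or.inl hX)) _ (hy X (Or.inl hX)) 1
          convert this using 1
          ring
        have heq : N' = N := by
          by_contra h
          exact hmin N' ⟨_, hU, hUfin, y, hy, hN'⟩ (lt_of_le_of_ne hle h)
        have hxy : (x - y) • d ∈ N' := by
          rw [heq, ← neg_mem_iff, ← neg_smul, hN]
          refine ⟨y - x, fun X hX => ?_, by rw [neg_sub]⟩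
          rw [add_sub_cancel]
          exact hy X (Or.inl hX)
        obtain ⟨w, hw, hwd⟩ := (hN' _).1 hxy
        refine ⟨y + w, fun X hX => ?_⟩
        rcases h𝓗 hX with rfl | hXM
        · simp only [Set.mem_ofPred_eq]
          rw [add_smul, hwd, sub_smul, add_sub_cancel]
        · exact hw X (Or.inr ⟨hX, hXM⟩)
    exact hmax.le_of_ge hmem (Set.subset_insert _ _) (Set.mem_insert _ _)
  choose f hf using dec
  obtain ⟨s, hs⟩ := hcl f (by
    intro F hF
    obtain ⟨s, hs⟩ := hFIP ((fun d => {t : S | t • d = f d}) '' F) (by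
      rintro _ ⟨d, -, rfl⟩; exact hf d) (hF.image _)
    exact ⟨s, fun d hd => (hs _ ⟨d, hd, rfl⟩).symm⟩)
  refine ⟨s, fun X hX => ?_⟩
  obtain ⟨F, hF, hFX⟩ := (h𝓕 X hX).2
  obtain ⟨t, ht⟩ := hFIP (insert X ((fun d => {t : S | t • d = f d}) '' F)) (by
    rintro _ (rfl | ⟨d, -, rfl⟩)
    · exact hsub hX
    · exact hf d) ((hF.image _).insert _)
  refine hFX t (ht X (Or.inl rfl)) s fun d hd => ?_
  have : t • d = f d := ht _ (Or.inr ⟨d, hd, rfl⟩)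
  rw [this, hs]

/-- the closure of (the image of) `S` in the endomorphisms of `D` -/
def Cl (S D : Type*) [CommRing S] [AddCommGroup D] [Module S D] :
    Subalgebra S (Module.End S D) where
  carrier := {f | ∀ F : Set D, F.Finite → ∃ s : S, ∀ d ∈ F, f d = s • d}
  mul_mem' := by
    intro f g hf hg F hF
    obtain ⟨t, ht⟩ := hg F hF
    obtain ⟨s, hs⟩ := hf (g '' F) (hF.image _)
    refine ⟨s * t, fun d hd => ?_⟩
    rw [Module.End.mul_apply, hs _ ⟨d, hd, rfl⟩, ht d hd, mul_smul]
  add_mem' := by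
    intro f g hf hg F hF
    obtain ⟨t, ht⟩ := hg F hF
    obtain ⟨s, hs⟩ := hf F hF
    refine ⟨s + t, fun d hd => ?_⟩
    rw [LinearMap.add_apply, hs d hd, ht d hd, add_smul]
  algebraMap_mem' := fun r F _ => ⟨r, fun d _ => rfl⟩

theorem Cl_comm {S D : Type*} [CommRing S] [AddCommGroup D] [Module S D] (f g : Cl S D) :
    f * g = g * f := by
  apply Subtype.ext
  ext d
  change f.1 (g.1 d) = g.1 (f.1 d)
  obtain ⟨s, hs⟩ := f.2 {d, g.1 d} (by simp)
  obtain ⟨t, ht⟩ := g.2 {d} (by simp)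
  rw [hs (g.1 d) (by simp), hs d (by simp), map_smul]

theorem hsl {S D : Type*} [CommRing S] [AddCommGroup D] [Module S D] [IsArtinian S D]
    (p : ℕ) (hp : 2 ≤ p) (θ : D →+ D) (hθ : ∀ (s : S) (m : D), θ (s • m) = s ^ p • θ m)
    (hnil : ∀ d, ∃ j : ℕ, (⇑θ)^[j] d = 0) : ∃ j : ℕ, ∀ d, (⇑θ)^[j] d = 0 := by
  let _ : CommRing (Cl S D) := { (inferInstance : Ring (Cl S D)) with mul_comm := Cl_comm }
  have : IsArtinian (Cl S D) D := isArtinian_of_tower S inferInstance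
  have hsm : ∀ (f : Cl S D) (d : D), f • d = f.1 d := fun f d => rfl
  refine hsl_LC (S := Cl S D) (LC_of_closed ?_) p hp θ ?_ hnil
  · intro f hf
    have hf' : ∀ F : Set D, F.Finite → ∃ s : S, ∀ d ∈ F, f d = s • d := by
      intro F hF
      obtain ⟨g, hg⟩ := hf F hF
      obtain ⟨s, hs⟩ := g.2 F hF
      exact ⟨s, fun d hd => by rw [hg d hd, hsm, hs d hd]⟩
    let f' : Module.End S D :=
      { toFun := f
        map_add' := by
          intro x y
          obtain ⟨s, hs⟩ := hf' {x, y, x + y} (by simp)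
          rw [hs x (by simp), hs y (by simp), hs (x + y) (by simp), smul_add]
        map_smul' := by
          intro r x
          obtain ⟨s, hs⟩ := hf' {x, r • x} (by simp)
          rw [hs x (by simp), hs (r • x) (by simp), smul_comm]; rfl }
    exact ⟨⟨f', hf'⟩, fun d => rfl⟩
  · intro f m
    have hpow : ∀ n : ℕ, ∀ x : D, f ^ n • x = (⇑f.1)^[n] x := by
      intro n
      induction n with
      | zero => intro x; simp
      | succ n ih => intro x; rw [pow_succ, mul_smul, ih, Function.iterate_succ_apply, hsm]
    obtain ⟨s, hs⟩ := f.2 (insert m ((fun n => (⇑f.1)^[n] (θ m)) '' Set.Iio p))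
      (((Set.finite_Iio p).image _).insert _)
    have h2 : ∀ n ≤ p, (⇑f.1)^[n] (θ m) = s ^ n • θ m := by
      intro n
      induction n with
      | zero => intro _; simp
      | succ n ih =>
        intro hn
        have h3 := hs ((⇑f.1)^[n] (θ m)) (Or.inr ⟨n, hn, rfl⟩)
        rw [Function.iterate_succ_apply', h3, ih (by omega), pow_succ',
          mul_smul]
    rw [hpow, h2 p le_rfl, hsm, hs m (Or.inl rfl), hθ]

/-- relative version -/
theorem hsl_rel {S M : Type*} [CommRing S] [AddCommGroup M] [Module S M] [IsArtinian S M]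
    (p : ℕ) (hp : 2 ≤ p)
    (θ : M →+ M) (hθ : ∀ (s : S) (m : M), θ (s • m) = s ^ p • θ m)
    (A : Submodule S M) (hA : ∀ m ∈ A, θ m ∈ A)
    (B : Submodule S M) (hB : ∀ m : M, m ∈ B ↔ ∃ j : ℕ, (⇑θ)^[j] m ∈ A) :
    ∃ j : ℕ, ∀ b ∈ B, (⇑θ)^[j] b ∈ A := by
  have hBst : ∀ b ∈ B, θ b ∈ B := by
    intro b hb
    obtain ⟨j, hj⟩ := (hB b).1 hb
    refine (hB _).2 ⟨j, ?_⟩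
    rw [← Function.iterate_succ_apply, Function.iterate_succ_apply']
    exact hA _ hj
  let θ' : M ⧸ A →+ M ⧸ A := QuotientAddGroup.map A.toAddSubgroup A.toAddSubgroup θ hA
  have hθ' : ∀ d, θ' (A.mkQ d) = A.mkQ (θ d) := fun d => rfl
  let W : Submodule S (M ⧸ A) := B.map A.mkQ
  have hWst : ∀ w ∈ W, θ' w ∈ W := by
    rintro _ ⟨b, hb, rfl⟩
    exact ⟨θ b, hBst b hb, rfl⟩
  let θ'' : W →+ W := (θ'.comp W.subtype.toAddMonoidHom).codRestrict W (fun w => hWst w w.2)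
  have hθ'' : ∀ w, ((θ'' w : W) : M ⧸ A) = θ' w := fun w => rfl
  have hit : ∀ j, ∀ b, ∀ hb : A.mkQ b ∈ W,
      (((⇑θ'')^[j] ⟨A.mkQ b, hb⟩ : W) : M ⧸ A) = A.mkQ ((⇑θ)^[j] b) := by
    intro j
    induction j with
    | zero => intro b hb; rfl
    | succ j ih =>
      intro b hb
      rw [Function.iterate_succ_apply, Function.iterate_succ_apply]
      exact ih (θ b) (hWst _ hb)
  obtain ⟨j, hj⟩ := hsl (S := S) p hp θ'' (by
    rintro s ⟨_, b, hb, rfl⟩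
    apply Subtype.ext
    rw [hθ'', W.coe_smul, W.coe_smul, hθ'', ← map_smul, hθ', hθ', hθ, map_smul]) (by
    rintro ⟨_, b, hb, rfl⟩
    obtain ⟨j, hj⟩ := (hB b).1 hb
    refine ⟨j, Subtype.ext ?_⟩
    exact (hit j b ⟨b, hb, rfl⟩).trans ((Submodule.Quotient.mk_eq_zero A).2 hj))
  refine ⟨j, fun b hb => ?_⟩
  have hb' : A.mkQ b ∈ W := ⟨b, hb, rfl⟩
  have := congrArg Subtype.val (hj ⟨A.mkQ b, hb'⟩)
  rw [hit] at this
  exact (Submodule.Quotient.mk_eq_zero A).1 this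

end HSL


theorem stmt_15 {S M : Type*} [CommRing S] [AddCommGroup M] [Module S M] [IsArtinian S M]
    (p : ℕ) (hp : p.Prime) [CharP S p]
    (θ : M →+ M) (hθ : ∀ (s : S) (m : M), θ (s • m) = s ^ p • θ m)
    (A : Submodule S M) (hA : ∀ m ∈ A, θ m ∈ A)
    -- `B` is the submodule with `B/A = Nil(M/A)`:
    (B : Submodule S M) (hB : ∀ m : M, m ∈ B ↔ ∃ j : ℕ, (⇑θ)^[j] m ∈ A) :
    (⨅ e : ℕ, Submodule.span S ((⇑θ)^[e] '' (A : Set M))) =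
      ⨅ e : ℕ, Submodule.span S ((⇑θ)^[e] '' (B : Set M)) := by
  obtain ⟨j, hj⟩ := HSL.hsl_rel p hp.two_le θ hθ A hA B hB
  apply le_antisymm
  · refine iInf_mono fun e => Submodule.span_mono (Set.image_mono fun a ha => ?_)
    exact (hB a).2 ⟨0, ha⟩
  · refine le_iInf fun e => (iInf_le _ (e + j)).trans (Submodule.span_mono ?_)
    rintro _ ⟨b, hb, rfl⟩
    exact ⟨(⇑θ)^[j] b, hj b hb, by rw [← Function.iterate_add_apply]⟩
end

section
/- Let S be a ring of characteristic p and 0 ⊆ N_1 ⊊ ... ⊊ N_s = M a chain of S[T;f]-submodules of an Artinian S[T;f]-module M such that each N_i satisfies Nil(M/N_i) = 0 and the chain is saturated among such submodules. Then for each 1 ≤ i ≤ s−1, the factor (N_{i+1}/N_i)* = ⋂_e S T^e (N_{i+1}/N_i) is a simple S[T;f]-module. -/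
/-- Linear compactness of the scalars, in the form needed below. -/
def LinC (S Q : Type*) [CommRing S] [AddCommGroup Q] [Module S Q] : Prop :=
  ∀ (N D : Submodule S Q) (x y : Q),
    (∀ V : Submodule S Q, V ≤ D → V.FG → ∃ a : S, (∀ v ∈ V, a • v ∈ N) ∧ a • x - y ∈ N) →
    ∃ a : S, (∀ v ∈ D, a • v ∈ N) ∧ a • x - y ∈ N

/-- A nonzero Noetherian submodule has a maximal proper submodule. -/
theorem exists_maximal_below {S G : Type*} [CommRing S] [AddCommGroup G] [Module S G]
    (V : Submodule S G) [IsNoetherian S V] (hV : V ≠ ⊥) :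
    ∃ V' : Submodule S G, V' < V ∧ ∀ Z, V' < Z → Z ≤ V → V ≤ Z := by
  have : Nontrivial V := (Submodule.nontrivial_iff_ne_bot).2 hV
  obtain ⟨W, hW, -⟩ := (eq_top_or_exists_le_coatom (⊥ : Submodule S V)).resolve_left bot_ne_top
  have hmapW : (W.map V.subtype).comap V.subtype = W :=
    Submodule.comap_map_eq_of_injective V.injective_subtype W
  refine ⟨W.map V.subtype, lt_of_le_of_ne (Submodule.map_subtype_le V W) ?_, ?_⟩
  · intro h
    apply hW.1
    rw [← hmapW, h]
    simp
  · intro Z hZ hZV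
    have h1 : W ≤ Z.comap V.subtype := by
      rw [← hmapW]; exact Submodule.comap_mono hZ.le
    have h2 : W ≠ Z.comap V.subtype := by
      intro h
      apply hZ.not_ge
      intro z hz
      refine ⟨⟨z, hZV hz⟩, ?_, rfl⟩
      rw [h]; exact hz
    have h3 := hW.2 _ (lt_of_le_of_ne h1 h2)
    intro v hv
    have : (⟨v, hv⟩ : V) ∈ Z.comap V.subtype := by rw [h3]; trivial
    exact this

/-- Double annihilator property for finite length submodules of a cocyclic module. -/
theorem double_ann_fl {S G : Type*} [CommRing S] [AddCommGroup G] [Module S G] [IsArtinian S G]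
    (g : G) (hg0 : g ≠ 0) (hg : ∀ y : G, y ≠ 0 → ∃ t : S, t • y = g) :
    ∀ V : Submodule S G, IsNoetherian S V →
      ∀ x : G, (∀ c : S, (∀ v ∈ V, c • v = 0) → c • x = 0) → x ∈ V := by
  intro V
  induction V using WellFoundedLT.induction with
  | ind V ih =>
  intro hN x hx
  by_cases hV : V = ⊥
  · subst hV
    have := hx 1 (by intro v hv; simpa using hv)
    simpa using this
  obtain ⟨V', hlt, hmax⟩ := exists_maximal_below V hV
  have hN' : IsNoetherian S V' := isNoetherian_of_le hlt.le
  obtain ⟨v, hv, hv'⟩ := SetLike.exists_of_lt hlt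
  have hgen : ∀ w ∈ V, ∀ t : S, t • v ∉ V' → ∃ r : S, w - r • t • v ∈ V' := by
    intro w hw t ht
    have h1 : V' < V' ⊔ Submodule.span S {t • v} := by
      refine lt_of_le_of_ne le_sup_left ?_
      intro h
      apply ht
      rw [h]
      exact Submodule.mem_sup_right (Submodule.mem_span_singleton_self _)
    have h2 : V' ⊔ Submodule.span S {t • v} ≤ V := by
      refine sup_le hlt.le ?_
      rw [Submodule.span_singleton_le_iff_mem]
      exact V.smul_mem _ hv
    have h3 := hmax _ h1 h2 hw
    obtain ⟨a, ha, b, hb, hab⟩ := Submodule.mem_sup.1 h3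
    obtain ⟨r, rfl⟩ := Submodule.mem_span_singleton.1 hb
    refine ⟨r, ?_⟩
    rw [← hab]; simpa using ha
  have hkill : ∀ c : S, (∀ u ∈ V', c • u = 0) → c • v = 0 → ∀ w ∈ V, c • w = 0 := by
    intro c h1 h2 w hw
    obtain ⟨r, hr⟩ := hgen w hw 1 (by simpa using hv')
    have := h1 _ hr
    rw [smul_sub, one_smul, smul_comm c r v, h2, smul_zero, sub_zero] at this
    exact this
  -- elements killed by the maximal ideal are multiples of `g`
  have hsoc : ∀ y : G, (∀ r : S, r • v ∈ V' → r • y = 0) → ∃ u : S, y = u • g := by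
    intro y hy
    by_cases hy0 : y = 0
    · exact ⟨0, by simp [hy0]⟩
    obtain ⟨t, ht⟩ := hg y hy0
    have htv : t • v ∉ V' := by
      intro h
      apply hg0
      rw [← ht, hy t h]
    obtain ⟨r, hr⟩ := hgen v hv t htv
    have h1 : (1 - r * t) • v ∈ V' := by
      rw [sub_smul, one_smul, mul_smul]; exact hr
    have h2 := hy _ h1
    rw [sub_smul, one_smul, mul_smul, ht, sub_eq_zero] at h2
    exact ⟨r, h2⟩
  have hJ : ∀ c : S, (∀ u ∈ V', c • u = 0) → ∀ r : S, r • v ∈ V' → r • c • v = 0 := by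
    intro c hc r hr
    rw [smul_comm]; exact hc _ hr
  by_cases hcase : ∀ c : S, (∀ u ∈ V', c • u = 0) → c • v = 0
  · exact hlt.le (ih V' hlt hN' x fun c hc => hx c (hkill c hc (hcase c hc)))
  push Not at hcase
  obtain ⟨r1, hr1, hr1v⟩ := hcase
  obtain ⟨t, ht⟩ := hg _ hr1v
  obtain ⟨r0, hr0, hr0v⟩ : ∃ r0 : S, (∀ u ∈ V', r0 • u = 0) ∧ r0 • v = g :=
    ⟨t * r1, fun u hu => by rw [mul_smul, hr1 u hu, smul_zero], by rw [mul_smul, ht]⟩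
  obtain ⟨u, hu⟩ := hsoc (r0 • x) (by
    intro r hr
    rw [← mul_smul]
    apply hx
    apply hkill
    · intro w hw; rw [mul_smul, hr0 w hw, smul_zero]
    · rw [mul_smul]; exact hJ r0 hr0 r hr)
  have hx' : x - u • v ∈ V' := by
    apply ih V' hlt hN'
    intro r hr
    obtain ⟨w, hw⟩ := hsoc (r • v) (hJ r hr)
    have h1 : (r - w * r0) • x = 0 := by
      apply hx
      apply hkill
      · intro z hz; rw [sub_smul, mul_smul, hr z hz, hr0 z hz, smul_zero, sub_zero]
      · rw [sub_smul, mul_smul, hr0v, hw, sub_self]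
    rw [sub_smul, mul_smul, sub_eq_zero] at h1
    rw [smul_sub, h1, hu, smul_comm r u v, hw, smul_comm, sub_self]
  have := V.add_mem (hlt.le hx') (V.smul_mem u hv)
  simpa using this

/-- Double annihilator property for all submodules of a cocyclic module. -/
theorem double_ann {S G : Type*} [CommRing S] [AddCommGroup G] [Module S G] [IsArtinian S G]
    (hLC : LinC S G) (g : G) (hg0 : g ≠ 0) (hg : ∀ y : G, y ≠ 0 → ∃ t : S, t • y = g)
    (D : Submodule S G) (x : G) (hx : ∀ c : S, (∀ v ∈ D, c • v = 0) → c • x = 0) : x ∈ D := by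
  by_contra hxD
  let H : Submodule S G → Submodule S G := fun V =>
    Submodule.map (LinearMap.toSpanSingleton S G x) V.annihilator
  have hHmem : ∀ V y, y ∈ H V ↔ ∃ a : S, (∀ v ∈ V, a • v = 0) ∧ a • x = y := by
    intro V y
    simp only [H, Submodule.mem_map, Submodule.mem_annihilator, LinearMap.toSpanSingleton_apply]
  obtain ⟨_, ⟨V0, ⟨hV0D, hV0fg⟩, rfl⟩, hmin⟩ := IsArtinian.set_has_minimal
    (H '' {V | V ≤ D ∧ V.FG}) ⟨_, ⊥, ⟨bot_le, Submodule.fg_bot⟩, rfl⟩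
  have hne : H V0 ≠ ⊥ := by
    intro h0
    apply hxD
    apply hV0D
    have : Module.Finite S V0 := Module.Finite.iff_fg.2 hV0fg
    apply double_ann_fl g hg0 hg V0 (isNoetherian_of_finite_isArtinian _)
    intro c hc
    have : c • x ∈ H V0 := (hHmem _ _).2 ⟨c, hc, rfl⟩
    rw [h0] at this
    simpa using this
  obtain ⟨y, hy, hy0⟩ := (Submodule.ne_bot_iff _).1 hne
  obtain ⟨a, ha, hax⟩ := hLC ⊥ D x y (by
    intro V hV hVfg
    have h1 : H (V ⊔ V0) ≤ H V0 := by
      intro z hz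
      obtain ⟨a, ha, h⟩ := (hHmem _ _).1 hz
      exact (hHmem _ _).2 ⟨a, fun v hv => ha v (Submodule.mem_sup_right hv), h⟩
    have h2 : H (V ⊔ V0) = H V0 := by
      by_contra hne
      exact hmin _ ⟨_, ⟨sup_le hV hV0D, hVfg.sup hV0fg⟩, rfl⟩ (lt_of_le_of_ne h1 hne)
    rw [← h2] at hy
    obtain ⟨a, ha, h⟩ := (hHmem _ _).1 hy
    exact ⟨a, fun v hv => by simpa using ha v (Submodule.mem_sup_left hv), by simp [h]⟩)
  have h1 := hx a (fun v hv => by simpa using ha v hv)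
  rw [h1] at hax
  apply hy0
  simpa using hax

theorem LinC.quotient {S Q : Type*} [CommRing S] [AddCommGroup Q] [Module S Q]
    (h : LinC S Q) (K : Submodule S Q) : LinC S (Q ⧸ K) := by
  intro N D x y hF
  obtain ⟨x, rfl⟩ := K.mkQ_surjective x
  obtain ⟨y, rfl⟩ := K.mkQ_surjective y
  obtain ⟨a, ha, hax⟩ := h (N.comap K.mkQ) (D.comap K.mkQ) x y (by
    intro V hV hVfg
    obtain ⟨a, ha, hax⟩ := hF (V.map K.mkQ) (Submodule.map_le_iff_le_comap.2 hV) (hVfg.map _)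
    refine ⟨a, fun v hv => ?_, ?_⟩
    · simpa using ha _ (Submodule.mem_map_of_mem hv)
    · simpa using hax)
  refine ⟨a, fun v hv => ?_, ?_⟩
  · obtain ⟨v, rfl⟩ := K.mkQ_surjective v
    simpa using ha v hv
  · simpa using hax

/-- An ascending chain of submodules cannot have infinitely many factors that are faithful modulo
a prime `P` annihilating the module. -/
theorem no_chain {S Q : Type*} [CommRing S] [AddCommGroup Q] [Module S Q] [IsArtinian S Q]
    (hLC : LinC S Q) (P : Ideal S) [hP : P.IsPrime] (B : Submodule S Q) :
    ∀ X : Submodule S Q, (∀ c ∈ P, ∀ x ∈ X, c • x ∈ B) →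
      ∀ K : ℕ → Submodule S Q, Monotone K → (∀ e, B ≤ K e) → (∀ e, K e ≤ X) →
      (∀ e, ∃ f, e ≤ f ∧ ∀ c : S, (∀ x ∈ K f, c • x ∈ K e) → c ∈ P) → False := by
  intro X
  induction X using WellFoundedLT.induction with
  | ind X ih =>
  intro hPX K hK hBK hKX hch
  have hone : (1 : S) ∉ P := (Ideal.ne_top_iff_one P).1 hP.ne_top
  have hXB : ¬ X ≤ B := by
    intro h
    obtain ⟨f, -, hf⟩ := hch 0
    apply hone
    apply hf
    intro x hx
    rw [one_smul]
    exact hBK 0 (h (hKX f hx))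
  obtain ⟨g, hgX, hgB⟩ := SetLike.not_le_iff_exists.1 hXB
  obtain ⟨N, hBN, hNmax⟩ := zorn_le_nonempty₀ {N : Submodule S Q | g ∉ N} (by
    intro c hc hchain y hy
    refine ⟨sSup c, ?_, fun z hz => le_sSup hz⟩
    intro hg
    obtain ⟨s, hs, hgs⟩ := (Submodule.mem_sSup_of_directed ⟨y, hy⟩ hchain.directedOn).1 hg
    exact hc hs hgs) B hgB
  have hgN : g ∉ N := hNmax.prop
  have hcoc : ∀ y : Q ⧸ N, y ≠ 0 → ∃ t : S, t • y = N.mkQ g := by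
    intro y hy
    obtain ⟨y, rfl⟩ := N.mkQ_surjective y
    have hyN : y ∉ N := by
      intro h; apply hy; simpa using h
    have : g ∈ N ⊔ Submodule.span S {y} := by
      by_contra h
      apply hyN
      exact hNmax.le_of_ge h le_sup_left
        (Submodule.mem_sup_right (Submodule.mem_span_singleton_self _))
    obtain ⟨a, ha, b, hb, hab⟩ := Submodule.mem_sup.1 this
    obtain ⟨t, rfl⟩ := Submodule.mem_span_singleton.1 hb
    refine ⟨t, ?_⟩
    rw [← hab, map_add, map_smul]
    have : N.mkQ a = 0 := by simpa using ha
    rw [this, zero_add]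
  have hDA : ∀ (D : Submodule S Q) (x : Q), (∀ c : S, (∀ v ∈ D, c • v ∈ N) → c • x ∈ N) →
      x ∈ D ⊔ N := by
    intro D x hx
    have h := double_ann (hLC.quotient N) (N.mkQ g) (by simpa using hgN) hcoc (D.map N.mkQ)
      (N.mkQ x) (by
        intro c hc
        have := hx c (by
          intro v hv
          have := hc _ (Submodule.mem_map_of_mem hv)
          rw [← map_smul] at this
          exact (Submodule.Quotient.mk_eq_zero N).1 this)
        rw [← map_smul]
        exact (Submodule.Quotient.mk_eq_zero N).2 this)
    have h' : x ∈ (D.map N.mkQ).comap N.mkQ := h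
    rw [Submodule.comap_map_mkQ] at h'
    rwa [sup_comm]
  have hlt : X ⊓ N < X := lt_of_le_of_ne inf_le_left (fun h => hgN (by
    have : g ∈ X ⊓ N := by rw [h]; exact hgX
    exact this.2))
  have hN := ih (X ⊓ N) hlt (fun c hc x hx => hPX c hc x hx.1) (fun e => K e ⊓ N)
    (fun a b hab => inf_le_inf_right _ (hK hab)) (fun e => le_inf (hBK e) hBN)
    (fun e => inf_le_inf_right _ (hKX e))
  have hN2 : ∃ e, ∀ f, e ≤ f → ∃ c : S, (∀ x ∈ K f ⊓ N, c • x ∈ K e ⊓ N) ∧ c ∉ P := by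
    by_contra hcon
    push Not at hcon
    exact hN hcon
  obtain ⟨e, he⟩ := hN2
  by_cases hfaith : ∃ f, ∀ c : S, (∀ x ∈ K f, c • x ∈ N) → c ∈ P
  · obtain ⟨f, hf⟩ := hfaith
    have hfull : ∀ x ∈ X, x ∈ K f ⊔ N := by
      intro x hx
      apply hDA
      intro c hc
      exact hBN (hPX c (hf c hc) x hx)
    obtain ⟨f', hf', hcol⟩ := hch (max e f)
    obtain ⟨c, hc, hcP⟩ := he f' ((le_max_left _ _).trans hf')
    apply hcP
    apply hcol
    intro k hk
    obtain ⟨k', hk', n, hn, hkn⟩ := Submodule.mem_sup.1 (hfull k (hKX _ hk))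
    have hk'2 : k' ∈ K (max e f) := hK (le_max_right _ _) hk'
    have hn' : n ∈ K f' := by
      have : n = k - k' := by rw [← hkn]; simp
      rw [this]
      exact (K f').sub_mem hk (hK hf' hk'2)
    rw [← hkn, smul_add]
    exact (K _).add_mem ((K _).smul_mem _ hk'2) (hK (le_max_left _ _) (hc n ⟨hn', hn⟩).1)
  · push Not at hfaith
    obtain ⟨f, hef, hcol⟩ := hch e
    obtain ⟨c, hc, hcP⟩ := he f hef
    obtain ⟨d, hd, hdP⟩ := hfaith f
    have : c * d ∈ P := by
      apply hcol
      intro x hx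
      rw [mul_smul]
      exact (hc _ ⟨(K f).smul_mem d hx, hd x hx⟩).1
    exact (hP.mem_or_mem this).elim hcP hdP

theorem iter_smul {S Q : Type*} [CommRing S] [AddCommGroup Q] [Module S Q] (p : ℕ)
    (T : Q →+ Q) (hT : ∀ (s : S) (m : Q), T (s • m) = s ^ p • T m) (e : ℕ) (s : S) (x : Q) :
    (⇑T)^[e] (s • x) = s ^ (p ^ e) • (⇑T)^[e] x := by
  induction e with
  | zero => simp
  | succ e ih =>
    rw [Function.iterate_succ_apply', ih, hT, ← pow_mul, ← pow_succ, Function.iterate_succ_apply']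

theorem span_step {S Q : Type*} [CommRing S] [AddCommGroup Q] [Module S Q] (p : ℕ)
    (T : Q →+ Q) (hT : ∀ (s : S) (m : Q), T (s • m) = s ^ p • T m) (e : ℕ) (Y : Submodule S Q) :
    Submodule.span S (⇑T '' (Submodule.span S ((⇑T)^[e] '' (Y : Set Q)) : Set Q)) =
      Submodule.span S ((⇑T)^[e + 1] '' (Y : Set Q)) := by
  apply le_antisymm
  · rw [Submodule.span_le]
    rintro _ ⟨x, hx, rfl⟩
    induction hx using Submodule.span_induction with
    | mem x hx =>
      obtain ⟨y, hy, rfl⟩ := hx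
      exact Submodule.subset_span ⟨y, hy, Function.iterate_succ_apply' _ _ _⟩
    | zero => rw [map_zero]; exact Submodule.zero_mem _
    | add x y _ _ hx hy => rw [map_add]; exact Submodule.add_mem _ hx hy
    | smul a x _ hx => rw [hT]; exact Submodule.smul_mem _ _ hx
  · rw [Submodule.span_le]
    rintro _ ⟨y, hy, rfl⟩
    exact Submodule.subset_span ⟨(⇑T)^[e] y, Submodule.subset_span ⟨y, hy, rfl⟩,
      (Function.iterate_succ_apply' _ _ _).symm⟩

theorem iter_add {Q : Type*} [AddCommGroup Q] (T : Q →+ Q) (e : ℕ) (x y : Q) :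
    (⇑T)^[e] (x + y) = (⇑T)^[e] x + (⇑T)^[e] y := iterate_map_add T e x y

/-- Hartshorne-Speiser-Lyubeznik for linearly compact scalars. -/
theorem hsl_linC {S Q : Type*} [CommRing S] [AddCommGroup Q] [Module S Q] [IsArtinian S Q]
    (hLC : LinC S Q) (p : ℕ) (hp : 2 ≤ p)
    (T : Q →+ Q) (hT : ∀ (s : S) (m : Q), T (s • m) = s ^ p • T m)
    (X0 : Submodule S Q) (hX0 : Submodule.span S (⇑T '' (X0 : Set Q)) = X0)
    (hnil : ∀ x ∈ X0, ∃ j : ℕ, (⇑T)^[j] x = 0) : X0 = ⊥ := by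
  by_contra hX0ne
  obtain ⟨X, ⟨hXX0, hXspan, hXne⟩, hXmin⟩ := IsArtinian.set_has_minimal
    {X : Submodule S Q | X ≤ X0 ∧ Submodule.span S (⇑T '' (X : Set Q)) = X ∧ X ≠ ⊥}
    ⟨X0, le_rfl, hX0, hX0ne⟩
  have hiter : ∀ e, Submodule.span S ((⇑T)^[e] '' (X : Set Q)) = X := by
    intro e
    induction e with
    | zero => simp
    | succ e ih => rw [← span_step p T hT, ih, hXspan]
  have hXT : ∀ x ∈ X, T x ∈ X := by
    intro x hx
    rw [← hXspan]; exact Submodule.subset_span ⟨x, hx, rfl⟩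
  have hXTe : ∀ e, ∀ x ∈ X, (⇑T)^[e] x ∈ X := by
    intro e x hx
    rw [← hiter e]; exact Submodule.subset_span ⟨x, hx, rfl⟩
  -- scalars killing `T^e X` kill `X`
  have hkillX : ∀ (e : ℕ) (c : S), (∀ x ∈ X, c • (⇑T)^[e] x = 0) → ∀ x ∈ X, c • x = 0 := by
    intro e c hc x hx
    rw [← hiter e] at hx
    induction hx using Submodule.span_induction with
    | mem x hx => obtain ⟨y, hy, rfl⟩ := hx; exact hc y hy
    | zero => simp
    | add x y _ _ hx hy => rw [smul_add, hx, hy, add_zero]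
    | smul a x _ hx => rw [smul_comm, hx, smul_zero]
  have hnotnil : ∀ e, ¬ ∀ x ∈ X, (⇑T)^[e] x = 0 := by
    intro e h
    apply hXne
    rw [Submodule.eq_bot_iff]
    intro x hx
    have := hkillX e 1 (fun x hx => by rw [h x hx, smul_zero]) x hx
    simpa using this
  -- proper stable submodules are nilpotent
  have hproper : ∀ Y : Submodule S Q, Y ≤ X → (∀ y ∈ Y, T y ∈ Y) → Y ≠ X →
      ∃ e, ∀ y ∈ Y, (⇑T)^[e] y = 0 := by
    intro Y hYX hYT hne
    have hanti : ∀ e, Submodule.span S ((⇑T)^[e + 1] '' (Y : Set Q)) ≤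
        Submodule.span S ((⇑T)^[e] '' (Y : Set Q)) := by
      intro e
      apply Submodule.span_mono
      rintro _ ⟨y, hy, rfl⟩
      exact ⟨T y, hYT y hy, rfl⟩
    obtain ⟨n, hn⟩ := IsArtinian.monotone_stabilizes
      (⟨fun e => OrderDual.toDual (Submodule.span S ((⇑T)^[e] '' (Y : Set Q))),
        monotone_nat_of_le_succ hanti⟩ : ℕ →o (Submodule S Q)ᵒᵈ)
    have hn1 : Submodule.span S ((⇑T)^[n] '' (Y : Set Q)) =
      Submodule.span S ((⇑T)^[n + 1] '' (Y : Set Q)) := hn (n + 1) (Nat.le_succ n)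
    have hle : Submodule.span S ((⇑T)^[n] '' (Y : Set Q)) ≤ Y := by
      rw [Submodule.span_le]
      rintro _ ⟨y, hy, rfl⟩
      clear hn hn1
      induction n with
      | zero => exact hy
      | succ n ih => rw [Function.iterate_succ_apply']; exact hYT _ ih
    have hbot : Submodule.span S ((⇑T)^[n] '' (Y : Set Q)) = ⊥ := by
      by_contra hb
      refine hXmin _ ⟨(hle.trans hYX).trans hXX0, ?_, hb⟩ (lt_of_le_of_lt hle
        (lt_of_le_of_ne hYX hne))
      rw [span_step p T hT, ← hn1]
    refine ⟨n, fun y hy => ?_⟩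
    have : (⇑T)^[n] y ∈ Submodule.span S ((⇑T)^[n] '' (Y : Set Q)) :=
      Submodule.subset_span ⟨y, hy, rfl⟩
    rw [hbot] at this
    simpa using this
  set P : Ideal S := X.annihilator.radical with hPdef
  have hPmem : ∀ s : S, s ∈ P ↔ ∃ n : ℕ, ∀ x ∈ X, s ^ n • x = 0 := by
    intro s
    rw [hPdef, Ideal.mem_radical_iff]
    simp only [Submodule.mem_annihilator]
  have hsurj : ∀ s : S, s ∉ P → ∀ x ∈ X, ∃ y ∈ X, s • y = x := by
    intro s hs
    by_contra hcon
    apply hs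
    obtain ⟨e, he⟩ := hproper (X.map (LinearMap.lsmul S Q s)) (by
        rintro _ ⟨x, hx, rfl⟩; exact X.smul_mem s hx) (by
        rintro _ ⟨x, hx, rfl⟩
        refine ⟨s ^ (p - 1) • T x, X.smul_mem _ (hXT x hx), ?_⟩
        simp only [LinearMap.lsmul_apply]
        rw [hT, ← mul_smul, ← pow_succ']
        congr 2
        omega) (by
        intro h
        apply hcon
        intro x hx
        rw [← h] at hx
        obtain ⟨y, hy, hyx⟩ := hx
        exact ⟨y, hy, hyx⟩)
    refine (hPmem s).2 ⟨p ^ e, hkillX e _ fun x hx => ?_⟩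
    rw [← iter_smul p T hT]
    exact he _ ⟨x, hx, rfl⟩
  have hsurjpow : ∀ s : S, s ∉ P → ∀ n : ℕ, ∀ x ∈ X, ∃ y ∈ X, s ^ n • y = x := by
    intro s hs n
    induction n with
    | zero => intro x hx; exact ⟨x, hx, by simp⟩
    | succ n ih =>
      intro x hx
      obtain ⟨y, hy, rfl⟩ := ih x hx
      obtain ⟨z, hz, rfl⟩ := hsurj s hs y hy
      exact ⟨z, hz, by rw [pow_succ, mul_smul]⟩
  have hPprime : P.IsPrime := by
    refine ⟨?_, ?_⟩
    · rw [Ideal.ne_top_iff_one, hPmem]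
      rintro ⟨n, hn⟩
      apply hXne
      rw [Submodule.eq_bot_iff]
      intro x hx
      simpa using hn x hx
    · intro a b hab
      by_contra hcon
      push Not at hcon
      obtain ⟨ha, hb⟩ := hcon
      apply hb
      obtain ⟨n, hn⟩ := (hPmem _).1 hab
      refine (hPmem _).2 ⟨n, fun x hx => ?_⟩
      obtain ⟨y, hy, rfl⟩ := hsurjpow a ha n x hx
      rw [← mul_smul, mul_comm, ← mul_pow]
      exact hn y hy
  -- `P` is nilpotent on `X`, so `P X ≠ X`
  have hPX : P • X ≠ X := by
    intro hPXX
    let Z : Ideal S → Submodule S Q := fun I =>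
      { carrier := {x | x ∈ X ∧ ∀ c ∈ I, c • x = 0}
        add_mem' := by
          rintro a b ⟨ha, ha'⟩ ⟨hb, hb'⟩
          exact ⟨X.add_mem ha hb, fun c hc => by rw [smul_add, ha' c hc, hb' c hc, add_zero]⟩
        zero_mem' := ⟨X.zero_mem, fun c _ => smul_zero c⟩
        smul_mem' := by
          rintro r a ⟨ha, ha'⟩
          exact ⟨X.smul_mem r ha, fun c hc => by rw [smul_comm, ha' c hc, smul_zero]⟩ }
    obtain ⟨_, ⟨I, ⟨hIP, hIfg⟩, rfl⟩, hmin⟩ := IsArtinian.set_has_minimal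
      (Z '' {I | I ≤ P ∧ I.FG}) ⟨_, ⊥, ⟨bot_le, Submodule.fg_bot⟩, rfl⟩
    have hZ : ∀ x ∈ X, (∀ c ∈ I, c • x = 0) → ∀ c ∈ P, c • x = 0 := by
      intro x hx hI c hc
      have hle : Z (I ⊔ Ideal.span {c}) ≤ Z I := fun y hy =>
        ⟨hy.1, fun d hd => hy.2 d (Submodule.mem_sup_left hd)⟩
      have heq : Z (I ⊔ Ideal.span {c}) = Z I := by
        by_contra hne
        refine hmin _ ⟨_, ⟨sup_le hIP ?_, Submodule.FG.sup hIfg (Submodule.fg_span_singleton c)⟩, rfl⟩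
          (lt_of_le_of_ne hle hne)
        rw [Ideal.span_le]; simpa using hc
      have hxZ : x ∈ Z I := ⟨hx, hI⟩
      rw [← heq] at hxZ
      exact hxZ.2 c (Submodule.mem_sup_right (Ideal.mem_span_singleton_self c))
    have hZ' : ∀ Y : Submodule S Q, Y ≤ X → I • Y = ⊥ → P • Y = ⊥ := by
      intro Y hY hIY
      rw [eq_bot_iff, Submodule.smul_le]
      intro c hc y hy
      rw [Submodule.mem_bot]
      refine hZ y (hY hy) (fun d hd => ?_) c hc
      have : d • y ∈ I • Y := Submodule.smul_mem_smul hd hy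
      rw [hIY] at this
      simpa using this
    have hpow : ∀ n : ℕ, ∀ Y : Submodule S Q, Y ≤ X → I ^ n • Y = ⊥ → P ^ n • Y = ⊥ := by
      intro n
      induction n with
      | zero => intro Y _ h; simpa using h
      | succ n ih =>
        intro Y hY h
        rw [pow_succ', Submodule.mul_smul] at h
        have h1 := hZ' _ (Submodule.smul_le_right.trans hY) h
        rw [← Submodule.mul_smul, mul_comm, Submodule.mul_smul] at h1
        have h2 := ih _ (Submodule.smul_le_right.trans hY) h1
        rw [pow_succ, Submodule.mul_smul, h2]
    obtain ⟨n, hn⟩ := Ideal.exists_pow_le_of_le_radical_of_fg hIP hIfg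
    have h1 : I ^ n • X = ⊥ := by
      rw [eq_bot_iff, Submodule.smul_le]
      intro c hc y hy
      exact (Submodule.mem_bot S).2 (Submodule.mem_annihilator.1 (hn hc) y hy)
    have h2 := hpow n X le_rfl h1
    have h3 : ∀ n : ℕ, P ^ n • X = X := by
      intro n
      induction n with
      | zero => simp
      | succ n ih => rw [pow_succ, Submodule.mul_smul, hPXX, ih]
    exact hXne ((h3 n).symm.trans h2)
  obtain ⟨e0, he0⟩ := hproper (P • X) Submodule.smul_le_right (by
    intro y hy
    refine Submodule.smul_induction_on hy (fun r hr n hn => ?_) (fun a b ha hb => ?_)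
    · rw [hT]
      exact Submodule.smul_mem_smul (P.pow_mem_of_mem hr p (by omega)) (hXT n hn)
    · rw [map_add]; exact Submodule.add_mem _ ha hb) hPX
  let K : ℕ → Submodule S Q := fun e =>
    { carrier := {x | x ∈ X ∧ (⇑T)^[e] x = 0}
      add_mem' := by
        rintro a b ⟨ha, ha'⟩ ⟨hb, hb'⟩
        exact ⟨X.add_mem ha hb, by rw [iter_add, ha', hb', add_zero]⟩
      zero_mem' := ⟨X.zero_mem, iterate_map_zero T e⟩
      smul_mem' := by
        rintro r a ⟨ha, ha'⟩
        exact ⟨X.smul_mem r ha, by rw [iter_smul p T hT, ha', smul_zero]⟩ }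
  have hKmono : Monotone K := by
    apply monotone_nat_of_le_succ
    rintro e x ⟨hx, hx'⟩
    exact ⟨hx, by rw [Function.iterate_succ_apply', hx', map_zero]⟩
  have hcolon : ∀ e, ∀ c : S, (∀ x ∈ K (e + 1), c • x ∈ K e) → c ∈ P := by
    intro e c hc
    by_contra hcP
    have h2 : ∀ j, ∀ x ∈ K (e + j), (c ^ 2) • x ∈ K e := by
      intro j
      induction j with
      | zero => intro x hx; exact (K e).smul_mem _ hx
      | succ j ih =>
        rintro x ⟨hx, hx'⟩
        have h3 : T x ∈ K (e + j) := ⟨hXT x hx, hx'⟩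
        have h4 : c • x ∈ K (e + 1) := by
          refine ⟨X.smul_mem c hx, ?_⟩
          rw [Function.iterate_succ_apply, hT]
          have h5 := (K e).smul_mem (c ^ (p - 2)) (ih _ h3)
          rw [← mul_smul, ← pow_add, Nat.sub_add_cancel hp] at h5
          exact h5.2
        rw [pow_two, mul_smul]
        exact hc _ h4
    apply hnotnil e
    intro x hx
    obtain ⟨y, hy, rfl⟩ := hsurjpow c hcP 2 x hx
    obtain ⟨j, hj⟩ := hnil y (hXX0 hy)
    exact (h2 j y (hKmono (Nat.le_add_left j e) ⟨hy, hj⟩)).2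
  refine no_chain hLC P (P • X) X (fun c hc x hx => Submodule.smul_mem_smul hc hx)
    (fun j => K (e0 + j)) (fun a b hab => hKmono (Nat.add_le_add_left hab e0))
    (fun e x hx => ?_) (fun e x hx => hx.1) (fun e => ⟨e + 1, Nat.le_succ e, ?_⟩)
  · exact hKmono (Nat.le_add_right e0 e) ⟨Submodule.smul_le_right hx, he0 x hx⟩
  · exact hcolon (e0 + e)

/-- Cosets of ideals (or the empty set). -/
def IsCos {S : Type*} [CommRing S] (C : Set S) : Prop :=
  ∀ a ∈ C, ∀ b ∈ C, ∀ c ∈ C, ∀ r : S, r * (a - b) + c ∈ C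

/-- Finite intersection property for families of cosets. -/
def CosFip {S : Type*} [CommRing S] (F : Set (Set S)) : Prop :=
  (∀ C ∈ F, IsCos C) ∧ ∀ t : Finset (Set S), (∀ C ∈ t, C ∈ F) → ∃ a : S, ∀ C ∈ t, a ∈ C

theorem CosFip.exists_point {S Q : Type*} [CommRing S] [AddCommGroup Q] [Module S Q]
    [IsArtinian S Q] (F : Set (Set S)) (hF : CosFip F) (q : Q) :
    ∃ y : Q, CosFip (insert {a : S | a • q = y} F) := by
  classical
  let D : Finset (Set S) → Submodule S Q := fun t =>
    Submodule.span S {z | ∃ a b : S, (∀ C ∈ t, a ∈ C) ∧ (∀ C ∈ t, b ∈ C) ∧ z = (a - b) • q}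
  have hD : ∀ t : Finset (Set S), (∀ C ∈ t, C ∈ F) → ∀ z ∈ D t, ∀ b : S, (∀ C ∈ t, b ∈ C) →
      ∃ a : S, (∀ C ∈ t, a ∈ C) ∧ z = (a - b) • q := by
    intro t ht z hz
    induction hz using Submodule.span_induction with
    | mem x hx =>
      intro b hb
      obtain ⟨a', b', ha', hb', rfl⟩ := hx
      refine ⟨1 * (a' - b') + b, fun C hC => hF.1 C (ht C hC) a' (ha' C hC) b' (hb' C hC) b
        (hb C hC) 1, ?_⟩
      congr 1; ring
    | zero => intro b hb; exact ⟨b, hb, by simp⟩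
    | add x y _ _ hx hy =>
      intro b hb
      obtain ⟨a', ha', rfl⟩ := hx b hb
      obtain ⟨a'', ha'', rfl⟩ := hy b hb
      refine ⟨1 * (a' - b) + a'', fun C hC => hF.1 C (ht C hC) a' (ha' C hC) b (hb C hC) a''
        (ha'' C hC) 1, ?_⟩
      rw [← add_smul]; congr 1; ring
    | smul r x _ hx =>
      intro b hb
      obtain ⟨a', ha', rfl⟩ := hx b hb
      refine ⟨r * (a' - b) + b, fun C hC => hF.1 C (ht C hC) a' (ha' C hC) b (hb C hC) b
        (hb C hC) r, ?_⟩
      rw [← mul_smul]; congr 1; ring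
  obtain ⟨_, ⟨t0, ht0, rfl⟩, hmin⟩ := IsArtinian.set_has_minimal
    (D '' {t | ∀ C ∈ t, C ∈ F}) ⟨_, ∅, by simp, rfl⟩
  obtain ⟨a0, ha0⟩ := hF.2 t0 ht0
  refine ⟨a0 • q, ?_, ?_⟩
  · intro C hC
    rcases hC with rfl | hC
    · intro a ha b hb c hc r
      simp only [Set.mem_ofPred_eq] at *
      rw [add_smul, mul_smul, sub_smul, ha, hb, hc]; simp
    · exact hF.1 C hC
  · intro t ht
    let t1 := t.filter (· ∈ F)
    have ht1 : ∀ C ∈ t1 ∪ t0, C ∈ F := by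
      intro C hC
      rcases Finset.mem_union.1 hC with h | h
      · exact (Finset.mem_filter.1 h).2
      · exact ht0 C h
    have hle : D (t1 ∪ t0) ≤ D t0 := by
      apply Submodule.span_mono
      rintro z ⟨a, b, ha, hb, rfl⟩
      exact ⟨a, b, fun C hC => ha C (Finset.mem_union_right _ hC),
        fun C hC => hb C (Finset.mem_union_right _ hC), rfl⟩
    have heq : D (t1 ∪ t0) = D t0 := by
      by_contra hne
      exact hmin _ ⟨_, ht1, rfl⟩ (lt_of_le_of_ne hle hne)
    obtain ⟨b, hb⟩ := hF.2 _ ht1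
    have hmem : (a0 - b) • q ∈ D (t1 ∪ t0) := by
      rw [heq]
      exact Submodule.subset_span ⟨a0, b, ha0, fun C hC => hb C (Finset.mem_union_right _ hC), rfl⟩
    obtain ⟨a, ha, haq⟩ := hD _ ht1 _ hmem b hb
    refine ⟨a, fun C hC => ?_⟩
    rcases ht C hC with rfl | hCF
    · simp only [Set.mem_ofPred_eq]
      rw [sub_smul, sub_smul] at haq
      exact (sub_left_injective haq).symm
    · exact ha C (Finset.mem_union_left _ (Finset.mem_filter.2 ⟨hC, hCF⟩))

theorem CosFip.exists_local {S Q : Type*} [CommRing S] [AddCommGroup Q] [Module S Q]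
    [IsArtinian S Q] (F0 : Set (Set S)) (hF0 : CosFip F0) :
    ∃ φ : Q → Q, ∀ (E : Finset Q) (t : Finset (Set S)), (∀ C ∈ t, C ∈ F0) →
      ∃ a : S, (∀ C ∈ t, a ∈ C) ∧ ∀ q ∈ E, φ q = a • q := by
  classical
  obtain ⟨F, hF0F, hFmax⟩ := zorn_subset_nonempty {F : Set (Set S) | CosFip F} (by
    intro c hc hchain hne
    refine ⟨⋃₀ c, ⟨?_, ?_⟩, fun s hs => Set.subset_sUnion_of_mem hs⟩
    · rintro C ⟨F, hF, hC⟩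
      exact (hc hF).1 C hC
    · intro t ht
      obtain ⟨F, hFc, hF⟩ : ∃ F ∈ c, (t : Set (Set S)) ⊆ F :=
        DirectedOn.exists_mem_subset_of_finset_subset_biUnion hne hchain.directedOn (by
          intro C hC
          obtain ⟨F, hF, hCF⟩ := ht C hC
          exact Set.mem_biUnion hF hCF)
      exact (hc hFc).2 t (fun C hC => hF hC)) F0 hF0
  have hpt : ∀ q : Q, ∃ y : Q, {a : S | a • q = y} ∈ F := by
    intro q
    obtain ⟨y, hy⟩ := CosFip.exists_point F hFmax.prop q
    exact ⟨y, hFmax.le_of_ge hy (Set.subset_insert _ _) (Set.mem_insert _ _)⟩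
  choose φ hφ using hpt
  refine ⟨φ, fun E t ht => ?_⟩
  obtain ⟨a, ha⟩ := hFmax.prop.2 (t ∪ E.image fun q => {a : S | a • q = φ q}) (by
    intro C hC
    rcases Finset.mem_union.1 hC with h | h
    · exact hF0F (ht C h)
    · obtain ⟨q, -, rfl⟩ := Finset.mem_image.1 h
      exact hφ q)
  refine ⟨a, fun C hC => ha C (Finset.mem_union_left _ hC), fun q hq => ?_⟩
  have := ha _ (Finset.mem_union_right _ (Finset.mem_image_of_mem _ hq))
  exact this.symm

/-- The ring of endomorphisms that are locally given by scalars. -/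
def locRing (S Q : Type*) [CommRing S] [AddCommGroup Q] [Module S Q] :
    Subalgebra S (Module.End S Q) where
  carrier := {φ | ∀ F : Finset Q, ∃ s : S, ∀ q ∈ F, φ q = s • q}
  mul_mem' := by
    classical
    intro φ ψ hφ hψ F
    obtain ⟨t, ht⟩ := hψ F
    obtain ⟨s, hs⟩ := hφ (F.image ψ)
    refine ⟨s * t, fun q hq => ?_⟩
    rw [Module.End.mul_apply, hs _ (Finset.mem_image_of_mem _ hq), ht q hq, mul_smul]
  add_mem' := by
    classical
    intro φ ψ hφ hψ F
    obtain ⟨t, ht⟩ := hψ F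
    obtain ⟨s, hs⟩ := hφ F
    exact ⟨s + t, fun q hq => by rw [LinearMap.add_apply, hs q hq, ht q hq, add_smul]⟩
  algebraMap_mem' := fun r F => ⟨r, fun q _ => by simp [Module.algebraMap_end_apply]⟩

noncomputable instance locRing.commRing (S Q : Type*) [CommRing S] [AddCommGroup Q] [Module S Q] :
    CommRing (locRing S Q) :=
  { (inferInstance : Ring (locRing S Q)) with
    mul_comm := by
      classical
      rintro ⟨φ, hφ⟩ ⟨ψ, hψ⟩
      apply Subtype.ext
      apply LinearMap.ext
      intro x
      change φ (ψ x) = ψ (φ x)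
      obtain ⟨s, hs⟩ := hφ {x, ψ x}
      obtain ⟨t, ht⟩ := hψ {x, φ x}
      rw [hs (ψ x) (by simp), ht x (by simp), ht (φ x) (by simp), hs x (by simp), smul_comm] }

theorem locRing.local_eq {S Q : Type*} [CommRing S] [AddCommGroup Q] [Module S Q]
    (φ : locRing S Q) (F : Finset Q) : ∃ s : S, ∀ q ∈ F, φ • q = s • q := φ.2 F

theorem locRing.linC {S Q : Type*} [CommRing S] [AddCommGroup Q] [Module S Q] [IsArtinian S Q] :
    LinC (locRing S Q) Q := by
  classical
  intro N D x y hV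
  have hNs : ∀ (s : S) (n : Q), n ∈ N → s • n ∈ N := fun s n hn => by
    have := N.smul_mem (algebraMap S (locRing S Q) s) hn
    rwa [algebraMap_smul] at this
  let F0 : Set (Set S) := insert {a : S | a • x - y ∈ N} ((fun d : Q => {a : S | a • d ∈ N}) '' D)
  have hF0 : CosFip F0 := by
    constructor
    · rintro C (rfl | ⟨d, hd, rfl⟩)
      · intro a ha b hb c hc r
        have h := N.add_mem (hNs r _ (N.sub_mem ha hb)) hc
        have e : (r * (a - b) + c) • x - y = r • (a • x - y - (b • x - y)) + (c • x - y) := by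
          rw [add_smul, mul_smul, sub_smul]; simp only [smul_sub]; abel
        simp only [Set.mem_ofPred_eq]
        rw [e]; exact h
      · intro a ha b hb c hc r
        have h := N.add_mem (hNs r _ (N.sub_mem ha hb)) hc
        simp only [Set.mem_ofPred_eq]
        rw [add_smul, mul_smul, sub_smul]; exact h
    · intro t ht
      have hch : ∀ C ∈ t, ∃ d ∈ D, C = {a : S | a • x - y ∈ N} ∨ C = {a : S | a • d ∈ N} := by
        intro C hC
        rcases ht C hC with h | ⟨d, hd, h⟩
        · exact ⟨0, D.zero_mem, Or.inl h⟩
        · exact ⟨d, hd, Or.inr h.symm⟩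
      choose! d hdD hd using hch
      obtain ⟨a, ha, hax⟩ := hV (Submodule.span _ ((t.image d : Finset Q) : Set Q)) (by
        rw [Submodule.span_le]
        intro z hz
        obtain ⟨C, hC, rfl⟩ := Finset.mem_image.1 (Finset.mem_coe.1 hz)
        exact hdD C hC) ⟨_, rfl⟩
      obtain ⟨s, hs⟩ := locRing.local_eq a (insert x (t.image d))
      refine ⟨s, fun C hC => ?_⟩
      rcases hd C hC with h | h
      · rw [h, Set.mem_ofPred_eq, ← hs x (Finset.mem_insert_self _ _)]
        exact hax
      · have hm : d C ∈ t.image d := Finset.mem_image_of_mem d hC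
        rw [h, Set.mem_ofPred_eq, ← hs (d C) (Finset.mem_insert_of_mem hm)]
        exact ha _ (Submodule.subset_span (Finset.mem_coe.2 hm))
  obtain ⟨φ, hφ⟩ := CosFip.exists_local (Q := Q) F0 hF0
  let ψ : Module.End S Q :=
    { toFun := φ
      map_add' := by
        intro u v
        obtain ⟨a, -, ha⟩ := hφ {u, v, u + v} ∅ (by simp)
        rw [ha u (by simp), ha v (by simp), ha (u + v) (by simp), smul_add]
      map_smul' := by
        intro r u
        obtain ⟨a, -, ha⟩ := hφ {u, r • u} ∅ (by simp)
        rw [ha u (by simp), ha (r • u) (by simp), smul_comm]; rfl }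
  refine ⟨⟨ψ, fun F => ?_⟩, fun v hv => ?_, ?_⟩
  · obtain ⟨a, -, ha⟩ := hφ F ∅ (by simp)
    exact ⟨a, ha⟩
  · obtain ⟨a, ha, ha'⟩ := hφ {v} {{a : S | a • v ∈ N}} (by
      intro C hC
      rw [Finset.mem_singleton.1 hC]
      exact Set.mem_insert_of_mem _ ⟨v, hv, rfl⟩)
    change φ v ∈ N
    rw [ha' v (by simp)]
    exact ha _ (Finset.mem_singleton_self _)
  · obtain ⟨a, ha, ha'⟩ := hφ {x} {{a : S | a • x - y ∈ N}} (by
      intro C hC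
      rw [Finset.mem_singleton.1 hC]
      exact Set.mem_insert _ _)
    change φ x - y ∈ N
    rw [ha' x (by simp)]
    exact ha _ (Finset.mem_singleton_self _)

/-- Hartshorne-Speiser-Lyubeznik, over an arbitrary commutative ring. -/
theorem hsl {S Q : Type*} [CommRing S] [AddCommGroup Q] [Module S Q] [IsArtinian S Q]
    (p : ℕ) (hp : 2 ≤ p)
    (T : Q →+ Q) (hT : ∀ (s : S) (m : Q), T (s • m) = s ^ p • T m)
    (X0 : Submodule S Q) (hX0 : Submodule.span S (⇑T '' (X0 : Set Q)) = X0)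
    (hnil : ∀ x ∈ X0, ∃ j : ℕ, (⇑T)^[j] x = 0) : X0 = ⊥ := by
  classical
  have hart : IsArtinian (locRing S Q) Q := isArtinian_of_tower S inferInstance
  have hpw : ∀ (φ : locRing S Q) (s : S) (n : ℕ) (m : Q),
      (∀ k < n, φ • φ ^ k • m = s • φ ^ k • m) → φ ^ n • m = s ^ n • m := by
    intro φ s n m
    induction n with
    | zero => intro _; simp
    | succ n ih =>
      intro h
      have h1 := ih (fun k hk => h k (hk.trans (Nat.lt_succ_self n)))
      rw [pow_succ', mul_smul, h n (Nat.lt_succ_self n), h1, ← mul_smul, ← pow_succ']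
  have hT' : ∀ (φ : locRing S Q) (m : Q), T (φ • m) = φ ^ p • T m := by
    intro φ m
    obtain ⟨s, hs⟩ := locRing.local_eq φ (insert m ((Finset.range p).image fun k => φ ^ k • T m))
    rw [hs m (Finset.mem_insert_self _ _), hT, hpw φ s p (T m)]
    intro k hk
    exact hs _ (Finset.mem_insert_of_mem (Finset.mem_image.2 ⟨k, Finset.mem_range.2 hk, rfl⟩))
  let X1 : Submodule (locRing S Q) Q :=
    { carrier := X0
      add_mem' := fun ha hb => X0.add_mem ha hb
      zero_mem' := X0.zero_mem
      smul_mem' := by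
        intro φ x hx
        obtain ⟨s, hs⟩ := locRing.local_eq φ {x}
        rw [hs x (by simp)]
        exact X0.smul_mem s hx }
  have h := hsl_linC (locRing.linC (S := S) (Q := Q)) p hp T hT' X1 (by
    apply le_antisymm
    · rw [Submodule.span_le]
      rintro _ ⟨x, hx, rfl⟩
      change T x ∈ X0
      rw [← hX0]
      exact Submodule.subset_span ⟨x, hx, rfl⟩
    · intro x hx
      have hx' : x ∈ X0 := hx
      rw [← hX0] at hx'
      exact Submodule.span_le_restrictScalars S (locRing S Q) _ hx') hnil
  rw [Submodule.eq_bot_iff]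
  intro x hx
  have : x ∈ X1 := hx
  rw [h] at this
  simpa using this

theorem exists_quot_map {S M : Type*} [CommRing S] [AddCommGroup M] [Module S M]
    (θ : M →+ M) (A : Submodule S M) (hA : ∀ m ∈ A, θ m ∈ A) :
    ∃ T : (M ⧸ A) →+ (M ⧸ A), ∀ m : M, T (A.mkQ m) = A.mkQ (θ m) :=
  ⟨QuotientAddGroup.map A.toAddSubgroup A.toAddSubgroup θ (fun m hm => hA m hm), fun _ => rfl⟩

theorem hsl_rel {S M : Type*} [CommRing S] [AddCommGroup M] [Module S M] [IsArtinian S M]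
    (p : ℕ) (hp : 2 ≤ p)
    (θ : M →+ M) (hθ : ∀ (s : S) (m : M), θ (s • m) = s ^ p • θ m)
    (A W : Submodule S M) (hA : ∀ m ∈ A, θ m ∈ A) (hθW : ∀ w ∈ W, θ w ∈ W)
    (hW : W ≤ Submodule.span S (⇑θ '' (W : Set M)) ⊔ A)
    (hnil : ∀ w ∈ W, ∃ j : ℕ, (⇑θ)^[j] w ∈ A) : W ≤ A := by
  obtain ⟨T, hTmk⟩ := exists_quot_map θ A hA
  have hTit : ∀ (j : ℕ) (m : M), (⇑T)^[j] (A.mkQ m) = A.mkQ ((⇑θ)^[j] m) := by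
    intro j
    induction j with
    | zero => intro m; rfl
    | succ j ih =>
      intro m
      rw [Function.iterate_succ_apply, hTmk, ih, Function.iterate_succ_apply]
  have hmk0 : ∀ m : M, A.mkQ m = 0 ↔ m ∈ A := fun m => Submodule.Quotient.mk_eq_zero A
  have hT : ∀ (s : S) (m : M ⧸ A), T (s • m) = s ^ p • T m := by
    intro r m
    obtain ⟨m, rfl⟩ := A.mkQ_surjective m
    rw [← map_smul, hTmk, hθ, map_smul, hTmk]
  have hspan : Submodule.span S (⇑T '' (W.map A.mkQ : Set (M ⧸ A))) = W.map A.mkQ := by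
    apply le_antisymm
    · rw [Submodule.span_le]
      rintro _ ⟨_, ⟨w, hw, rfl⟩, rfl⟩
      exact ⟨θ w, hθW w hw, (hTmk w).symm⟩
    · rw [Submodule.map_le_iff_le_comap]
      refine hW.trans (sup_le (Submodule.span_le.2 ?_) ?_)
      · rintro _ ⟨w, hw, rfl⟩
        exact Submodule.subset_span ⟨A.mkQ w, ⟨w, hw, rfl⟩, hTmk w⟩
      · intro b hb
        rw [Submodule.mem_comap, (hmk0 b).2 hb]
        exact Submodule.zero_mem _
  have hbot := hsl p hp T hT (W.map A.mkQ) hspan (by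
      rintro _ ⟨w, hw, rfl⟩
      obtain ⟨j, hj⟩ := hnil w hw
      exact ⟨j, by rw [hTit]; exact (hmk0 _).2 hj⟩)
  intro w hw
  have : A.mkQ w ∈ W.map A.mkQ := Submodule.mem_map_of_mem hw
  rw [hbot, Submodule.mem_bot] at this
  exact (hmk0 w).1 this

theorem anti_stab {S M : Type*} [CommRing S] [AddCommGroup M] [Module S M] [IsArtinian S M]
    (F : ℕ → Submodule S M) (hanti : ∀ e, F (e + 1) ≤ F e) :
    ∃ n, (∀ m, n ≤ m → F n = F m) ∧ (⨅ e, F e) = F n := by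
  obtain ⟨n, hn⟩ := IsArtinian.monotone_stabilizes
    (⟨fun e => OrderDual.toDual (F e), fun a b h => antitone_nat_of_succ_le hanti h⟩ :
      ℕ →o (Submodule S M)ᵒᵈ)
  have hn' : ∀ m, n ≤ m → F n = F m := fun m hm => hn m hm
  refine ⟨n, hn', le_antisymm (iInf_le _ n) (le_iInf fun e => ?_)⟩
  rw [hn' (max n e) (le_max_left _ _)]
  exact antitone_nat_of_succ_le hanti (le_max_right n e)

theorem exists_rad {S M : Type*} [CommRing S] [AddCommGroup M] [Module S M]
    (p : ℕ) (θ : M →+ M) (hθ : ∀ (s : S) (m : M), θ (s • m) = s ^ p • θ m)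
    (A : Submodule S M) (hA : ∀ m ∈ A, θ m ∈ A) :
    ∃ C : Submodule S M, ∀ m, m ∈ C ↔ ∃ j : ℕ, (⇑θ)^[j] m ∈ A := by
  have hAiter : ∀ (k : ℕ) (m : M), m ∈ A → (⇑θ)^[k] m ∈ A := by
    intro k
    induction k with
    | zero => intro m hm; exact hm
    | succ k ih => intro m hm; exact ih _ (hA m hm)
  refine ⟨
    { carrier := {m | ∃ j : ℕ, (⇑θ)^[j] m ∈ A}
      add_mem' := ?_
      zero_mem' := ⟨0, A.zero_mem⟩
      smul_mem' := ?_ }, fun m => Iff.rfl⟩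
  · rintro a b ⟨j, hj⟩ ⟨k, hk⟩
    refine ⟨j + k, ?_⟩
    rw [iter_add]
    refine A.add_mem ?_ ?_
    · rw [add_comm, Function.iterate_add_apply]; exact hAiter _ _ hj
    · rw [Function.iterate_add_apply]; exact hAiter _ _ hk
  · rintro r a ⟨j, hj⟩
    exact ⟨j, by rw [iter_smul p θ hθ]; exact A.smul_mem _ hj⟩

theorem main_aux {S M : Type*} [CommRing S] [AddCommGroup M] [Module S M] [IsArtinian S M]
    (p : ℕ) (hp : 2 ≤ p)
    (θ : M →+ M) (hθ : ∀ (s : S) (m : M), θ (s • m) = s ^ p • θ m)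
    (B L : Submodule S M) (hBL' : B < L)
    (hB : ∀ m ∈ B, θ m ∈ B) (hL : ∀ m ∈ L, θ m ∈ L)
    (hrB : ∀ m : M, (∃ j : ℕ, (⇑θ)^[j] m ∈ B) → m ∈ B)
    (hrL : ∀ m : M, (∃ j : ℕ, (⇑θ)^[j] m ∈ L) → m ∈ L)
    (hsat : ∀ C : Submodule S M, (∀ m ∈ C, θ m ∈ C) →
      (∀ m : M, (∃ j : ℕ, (⇑θ)^[j] m ∈ C) → m ∈ C) →
      B ≤ C → C ≤ L → C = B ∨ C = L)
    (F : ℕ → Submodule S M) (hF : ∀ e, F e = Submodule.span S ((⇑θ)^[e] '' (L : Set M)) ⊔ B)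
    (W : Submodule S M) (hWdef : W = ⨅ e, F e) :
    W ≠ B ∧ ∀ A : Submodule S M, (∀ m ∈ A, θ m ∈ A) → B ≤ A → A ≤ W → A = B ∨ A = W := by
  have hanti : ∀ e : ℕ, F (e + 1) ≤ F e := by
    intro e
    rw [hF, hF]
    apply sup_le_sup_right
    apply Submodule.span_mono
    rintro _ ⟨y, hy, rfl⟩
    exact ⟨θ y, hL y hy, (Function.iterate_succ_apply _ _ _).symm⟩
  obtain ⟨n, hn, hWn'⟩ := anti_stab F hanti
  have hWn : W = Submodule.span S ((⇑θ)^[n] '' (L : Set M)) ⊔ B := by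
    rw [hWdef, hWn', hF]
  have hWn1 : W = Submodule.span S ((⇑θ)^[n + 1] '' (L : Set M)) ⊔ B := by
    rw [hWdef, hWn', hn (n + 1) (Nat.le_succ n), hF]
  have hW0 : W ≤ L := by
    rw [hWdef]
    refine (iInf_le _ 0).trans ?_
    rw [hF]
    refine sup_le (Submodule.span_le.2 ?_) hBL'.le
    rintro _ ⟨y, hy, rfl⟩
    exact hy
  clear hWdef hWn' hn hanti hF
  constructor
  · intro hWB
    apply hBL'.not_ge
    intro m hm
    refine hrB m ⟨n, ?_⟩
    rw [← hWB, hWn]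
    exact Submodule.mem_sup_left (Submodule.subset_span ⟨m, hm, rfl⟩)
  intro A hA hBA hAW
  by_cases hAB : A = B
  · exact Or.inl hAB
  right
  obtain ⟨C, hC⟩ := exists_rad p θ hθ A hA
  have hAC : A ≤ C := fun m hm => (hC m).2 ⟨0, hm⟩
  have hCL : C = L := by
    refine (hsat C ?_ ?_ (hBA.trans hAC) ?_).resolve_left ?_
    · intro m hm
      obtain ⟨j, hj⟩ := (hC m).1 hm
      refine (hC _).2 ⟨j, ?_⟩
      rw [← Function.iterate_succ_apply, Function.iterate_succ_apply']
      exact hA _ hj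
    · rintro m ⟨j, hj⟩
      obtain ⟨k, hk⟩ := (hC _).1 hj
      exact (hC m).2 ⟨k + j, by rw [Function.iterate_add_apply]; exact hk⟩
    · intro m hm
      obtain ⟨j, hj⟩ := (hC m).1 hm
      exact hrL m ⟨j, hW0 (hAW hj)⟩
    · intro h
      rw [h] at hAC
      exact hAB (le_antisymm hAC hBA)
  have hθW : ∀ w ∈ W, θ w ∈ W := by
    intro w hw
    rw [hWn] at hw
    obtain ⟨a, ha, b, hb, rfl⟩ := Submodule.mem_sup.1 hw
    rw [map_add, hWn1]
    refine Submodule.add_mem _ ?_ (Submodule.mem_sup_right (hB b hb))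
    apply Submodule.mem_sup_left
    rw [← span_step p θ hθ]
    exact Submodule.subset_span ⟨a, ha, rfl⟩
  refine le_antisymm hAW (hsl_rel p hp θ hθ A W hA hθW ?_ ?_)
  · intro w hw
    rw [hWn1] at hw
    refine sup_le_sup (Submodule.span_mono ?_) hBA hw
    rintro _ ⟨l, hl, rfl⟩
    refine ⟨(⇑θ)^[n] l, ?_, (Function.iterate_succ_apply' _ _ _).symm⟩
    rw [hWn]
    exact Submodule.mem_sup_left (Submodule.subset_span ⟨l, hl, rfl⟩)
  · intro w hw
    rw [← hC, hCL]
    exact hW0 hw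



theorem stmt_18 {S M : Type*} [CommRing S] [AddCommGroup M] [Module S M] [IsArtinian S M]
    (p : ℕ) (hp : p.Prime) [CharP S p]
    (θ : M →+ M) (hθ : ∀ (s : S) (m : M), θ (s • m) = s ^ p • θ m)
    (s : ℕ) (hs : 1 ≤ s) (N : ℕ → Submodule S M)
    (htop : N s = ⊤)
    (hstrict : ∀ i : ℕ, 1 ≤ i → i < s → N i < N (i + 1))
    (hstable : ∀ i : ℕ, 1 ≤ i → i ≤ s → ∀ m ∈ N i, θ m ∈ N i)
    -- each `N i` satisfies `Nil(M/N i) = 0`: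
    (hred : ∀ i : ℕ, 1 ≤ i → i ≤ s → ∀ m : M, (∃ j : ℕ, (⇑θ)^[j] m ∈ N i) → m ∈ N i)
    -- the chain is saturated among such submodules:
    (hsat : ∀ i : ℕ, 1 ≤ i → i < s → ∀ C : Submodule S M, (∀ m ∈ C, θ m ∈ C) →
      (∀ m : M, (∃ j : ℕ, (⇑θ)^[j] m ∈ C) → m ∈ C) →
      N i ≤ C → C ≤ N (i + 1) → C = N i ∨ C = N (i + 1)) :
    ∀ i : ℕ, 1 ≤ i → i < s →
      -- `(N_{i+1}/N_i)* = W/N_i` is a nonzero simple `S[T;f]`-module, where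
      -- `W = ⋂_e (S T^e N_{i+1} + N_i)`:
      (⨅ e : ℕ, (Submodule.span S ((⇑θ)^[e] '' (N (i + 1) : Set M)) ⊔ N i)) ≠ N i ∧
      ∀ A : Submodule S M, (∀ m ∈ A, θ m ∈ A) → N i ≤ A →
        A ≤ (⨅ e : ℕ, (Submodule.span S ((⇑θ)^[e] '' (N (i + 1) : Set M)) ⊔ N i)) →
        A = N i ∨ A = ⨅ e : ℕ, (Submodule.span S ((⇑θ)^[e] '' (N (i + 1) : Set M)) ⊔ N i) := by
  intro i hi his
  exact main_aux p hp.two_le θ hθ (N i) (N (i + 1)) (hstrict i hi his)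
    (hstable i hi his.le) (hstable (i + 1) (by omega) (by omega))
    (hred i hi his.le) (hred (i + 1) (by omega) (by omega)) (hsat i hi his)
    _ (fun _ => rfl) _ rfl
end

section
/- Let R be a regular ring of characteristic p with the I_e operation, u ∈ R, I ⊆ R with u·I ⊆ I^[p], and J ⊇ I an ideal with u·J ⊆ J^[p]. Define J^{♯u} = ⋂_{e≥0} I_e(u^{ν_e}·J) + I. Then (J^{♯u})^{♯u} = J^{♯u}, i.e., the ♯ operation is idempotent. -/
/-- The `q`-th Frobenius power of an ideal: the ideal generated by `q`-th powers of its
elements. -/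
def fpow {R : Type*} [CommRing R] (q : ℕ) (J : Ideal R) : Ideal R :=
  Ideal.span ((fun a => a ^ q) '' (J : Set R))

/-- `ν_e = 1 + p + ... + p^{e-1}`. -/
def nu (p e : ℕ) : ℕ := ∑ i ∈ Finset.range e, p ^ i

/-- Krull intersection in the form needed here. -/
lemma krull_aux {R : Type*} [CommRing R] [IsNoetherianRing R] (c X : Ideal R) (x : R)
    (h : ∀ n : ℕ, x ∈ X ⊔ c ^ n) : ∃ r ∈ c, (1 - r) * x ∈ X := by
  have h1 : (Ideal.Quotient.mk X x : R ⧸ X) ∈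
      (⨅ i : ℕ, c ^ i • ⊤ : Submodule R (R ⧸ X)) := by
    rw [Submodule.mem_iInf]
    intro i
    obtain ⟨a, ha, b, hb, rfl⟩ := Submodule.mem_sup.mp (h i)
    have : (Ideal.Quotient.mk X (a + b)) = b • (1 : R ⧸ X) := by
      rw [map_add, Ideal.Quotient.eq_zero_iff_mem.mpr ha, zero_add, Algebra.smul_def, mul_one]
      rfl
    rw [this]
    exact Submodule.smul_mem_smul hb trivial
  rw [Ideal.mem_iInf_smul_pow_eq_bot_iff] at h1
  obtain ⟨r, hr⟩ := h1
  refine ⟨r, r.2, ?_⟩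
  rw [← Ideal.Quotient.eq_zero_iff_mem, sub_mul, one_mul, map_sub, sub_eq_zero, map_mul]
  rw [Algebra.smul_def] at hr
  exact hr.symm

lemma krull_all {R : Type*} [CommRing R] [IsNoetherianRing R] (X : Ideal R) (x : R)
    (h : ∀ m : Ideal R, m.IsMaximal → ∀ n : ℕ, x ∈ X ⊔ m ^ n) : x ∈ X := by
  by_contra hx
  have hne : X.colon {x} ≠ ⊤ := by
    intro ht
    have : (1 : R) ∈ X.colon {x} := ht ▸ trivial
    rw [Submodule.mem_colon_singleton, one_smul] at this
    exact hx this
  obtain ⟨m, hm, hle⟩ := Ideal.exists_le_maximal _ hne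
  obtain ⟨r, hr, hrx⟩ := krull_aux m X x (h m hm)
  have : (1 - r) ∈ m := hle (by rw [Submodule.mem_colon_singleton]; exact hrx)
  exact hm.ne_top ((Ideal.eq_top_iff_one m).mpr (by simpa using m.add_mem this hr))

/-- Frobenius powers commute with arbitrary intersections. -/
def InfComm (R : Type*) [CommRing R] (p : ℕ) [ExpChar R p] : Prop :=
  ∀ (e : ℕ) (S : Set (Ideal R)) (x : R),
    (∀ L ∈ S, x ∈ L.map (iterateFrobenius R p e)) → x ∈ (sInf S).map (iterateFrobenius R p e)

lemma map_frob_le {R : Type*} [CommRing R] (p : ℕ) (hp : p.Prime) [ExpChar R p] (e : ℕ)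
    (L : Ideal R) : L.map (iterateFrobenius R p e) ≤ L := by
  rw [Ideal.map_le_iff_le_comap]
  intro x hx
  rw [Ideal.mem_comap, iterateFrobenius_def]
  exact L.pow_mem_of_mem hx _ (pow_pos hp.pos e)

lemma map_span_sing {R : Type*} [CommRing R] (p : ℕ) [ExpChar R p] (e : ℕ) (s : R) :
    (Ideal.span {s}).map (iterateFrobenius R p e) = Ideal.span {s ^ p ^ e} := by
  rw [Ideal.map_span, Set.image_singleton, iterateFrobenius_def]

lemma local_nil {R : Type*} [CommRing R] [IsNoetherianRing R] (p : ℕ) (hp : p.Prime)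
    [ExpChar R p] (hinf : InfComm R p) (m : Ideal R) (hm : m.IsMaximal) (x : R)
    (hx : ∀ a, a ∈ m ↔ a * x = 0) (hxm : x ∈ m) (y : R) (hy : y ∈ m) :
    ∃ t, t ∉ m ∧ ∃ k : ℕ, t * y ^ k = 0 := by
  have h1 : ∃ n : ℕ, x ∉ Ideal.span {y ^ n} := by
    by_contra! hc
    obtain ⟨r, hr, h0⟩ := krull_aux (Ideal.span {y}) ⊥ x (fun n => by
      rw [Ideal.span_singleton_pow]; exact Ideal.mem_sup_right (hc n))
    have hr' : r ∈ m := (Ideal.span_singleton_le_iff_mem m).mpr hy hr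
    have : 1 - r ∈ m := (hx _).mpr (by simpa using h0)
    exact hm.ne_top ((Ideal.eq_top_iff_one m).mpr (by simpa using m.add_mem this hr'))
  obtain ⟨n, hn⟩ := h1
  set z := y ^ n with hz
  have hx2 : x ^ p ^ 1 = 0 := by
    have : x ^ 2 = 0 := by rw [pow_two]; exact (hx x).mp hxm
    rw [pow_one]
    exact pow_eq_zero_of_le hp.two_le this
  have h2 : z ^ p ^ 1 ∈ (sInf {Ideal.span {z}, Ideal.span {z + x}}).map
      (iterateFrobenius R p 1) := by
    apply hinf
    rintro L (rfl | rfl)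
    · rw [map_span_sing]; exact Ideal.mem_span_singleton_self _
    · rw [map_span_sing, add_pow_expChar_pow, hx2, add_zero]; exact Ideal.mem_span_singleton_self _
  have h3 : sInf {Ideal.span {z}, Ideal.span {z + x}} ≤ Ideal.span {z} * m := by
    intro w hw
    rw [sInf_pair] at hw
    obtain ⟨hw1, hw2⟩ := hw
    obtain ⟨f, rfl⟩ := Ideal.mem_span_singleton'.mp hw2
    have hf : f * x ∈ Ideal.span {z} := by
      have := Ideal.sub_mem _ hw1 (Ideal.mul_mem_left _ f (Ideal.mem_span_singleton_self z))
      convert this using 1; ring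
    have hfm : f ∈ m := by
      by_contra hfm
      obtain ⟨g, i, hi, hg⟩ := hm.exists_inv hfm
      apply hn
      have h4 : x = g * (f * x) := by
        have := (hx i).mp hi
        linear_combination (-x) * hg + this
      rw [h4]; exact Ideal.mul_mem_left _ _ hf
    rw [mul_add, (hx f).mp hfm, add_zero, mul_comm f z]
    exact Ideal.mul_mem_mul (Ideal.mem_span_singleton_self z) hfm
  have h4 := Ideal.map_mono h3 h2
  rw [Ideal.map_mul, map_span_sing, Ideal.mem_span_singleton_mul] at h4
  obtain ⟨g, hg, hgz⟩ := h4
  have hgm : g ∈ m := map_frob_le p hp 1 m hg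
  refine ⟨1 - g, fun h => hm.ne_top ((Ideal.eq_top_iff_one m).mpr (by simpa using m.add_mem h hgm)),
    n * p ^ 1, ?_⟩
  rw [pow_mul, ← hz]
  linear_combination -hgz

/-- If every element of a f.g. ideal is killed by something outside a prime, so is the ideal. -/
lemma exists_common {R : Type*} [CommRing R] [IsNoetherianRing R] (m : Ideal R) (hm : m.IsPrime)
    (A B : Ideal R) (h : ∀ a ∈ A, ∃ t, t ∉ m ∧ t * a ∈ B) :
    ∃ t, t ∉ m ∧ ∀ a ∈ A, t * a ∈ B := by
  classical
  obtain ⟨S, hS⟩ := (IsNoetherian.noetherian A : A.FG)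
  have hs : ∀ a ∈ S, a ∈ A := fun a ha => hS ▸ Ideal.subset_span ha
  choose! f hf using h
  refine ⟨∏ a ∈ S, f a, ?_, ?_⟩
  · intro hc
    obtain ⟨a, ha, hfa⟩ := (hm.prod_mem_iff).mp hc
    exact (hf a (hs a ha)).1 hfa
  · have : A ≤ B.colon {∏ a ∈ S, f a} := by
      rw [← hS, Ideal.span_le]
      intro a ha
      rw [SetLike.mem_coe, Submodule.mem_colon_singleton, smul_eq_mul, ← Finset.mul_prod_erase S f ha]
      have := B.mul_mem_right (∏ x ∈ S.erase a, f x) (hf a (hs a ha)).2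
      convert this using 1; ring
    intro a ha
    have := this ha
    rw [Submodule.mem_colon_singleton, smul_eq_mul] at this
    rwa [mul_comm]

lemma dichotomy {R : Type*} [CommRing R] [IsNoetherianRing R] (p : ℕ) (hp : p.Prime)
    [ExpChar R p] (hinf : InfComm R p) (m : Ideal R) (hm : m.IsMaximal) :
    (∃ y ∈ m, y ∈ nonZeroDivisors R) ∨
      ∃ t, t ∉ m ∧ ∃ n : ℕ, ∀ a ∈ m ^ n, t * a = 0 := by
  by_cases hnz : ∃ y ∈ m, y ∈ nonZeroDivisors R
  · exact Or.inl hnz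
  right
  push Not at hnz
  have hmem : m ∈ associatedPrimes R R := by
    obtain ⟨P, hP, hle⟩ := (m.subset_union_prime_finite (associatedPrimes.finite R R) (f := id) 0 0
      fun _ h _ _ ↦ h.1).1 (by
        simp_rw [id, biUnion_associatedPrimes_eq_compl_nonZeroDivisors]
        exact fun x hx h => hnz x hx h)
    exact hm.eq_of_le hP.isPrime.ne_top hle ▸ hP
  rw [AssociatedPrimes.mem_iff, isAssociatedPrime_iff] at hmem
  obtain ⟨-, x, hmx⟩ := hmem
  have hx : ∀ a, a ∈ m ↔ a * x = 0 := by
    intro a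
    rw [hmx, Submodule.mem_colon_singleton]; simp
  by_cases hxm : x ∈ m
  · have hnil := local_nil p hp hinf m hm x hx hxm
    have hprime := hm.isPrime
    let S := Localization.AtPrime m
    have h1 : m.map (algebraMap R S) ≤ nilradical S := by
      rw [Ideal.map_le_iff_le_comap]
      intro y hy
      obtain ⟨t, ht, k, htk⟩ := hnil y hy
      rw [Ideal.mem_comap, mem_nilradical]
      refine ⟨k, ?_⟩
      rw [← map_pow]
      exact (IsLocalization.map_eq_zero_iff m.primeCompl S _).mpr ⟨⟨t, ht⟩, htk⟩
    obtain ⟨n, hn⟩ := Ideal.exists_pow_le_of_le_radical_of_fg h1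
      (IsNoetherian.noetherian (m.map (algebraMap R S)))
    obtain ⟨t, ht, hta⟩ := exists_common m hprime (m ^ n) ⊥ (by
      intro a ha
      have : algebraMap R S a = 0 := by
        have h2 := Ideal.mem_map_of_mem (algebraMap R S) ha
        rw [Ideal.map_pow] at h2
        simpa using hn h2
      obtain ⟨t, ht⟩ := (IsLocalization.map_eq_zero_iff m.primeCompl S _).mp this
      exact ⟨t, t.2, ht⟩)
    exact ⟨t, ht, n, fun a ha => by simpa using hta a ha⟩
  · exact ⟨x, hxm, 1, fun a ha => by
      rw [pow_one] at ha; rw [mul_comm]; exact (hx a).mp ha⟩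

/-- coset avoidance: if `y` is regular, some `s + y r` is regular. -/
lemma exists_regular_add {R : Type*} [CommRing R] [IsNoetherianRing R] (y s : R)
    (hy : y ∈ nonZeroDivisors R) : ∃ r, s + y * r ∈ nonZeroDivisors R := by
  have hnzd : ∀ a : R, a ∈ nonZeroDivisors R ↔ ∀ P ∈ associatedPrimes R R, a ∉ P := by
    intro a
    have := biUnion_associatedPrimes_eq_compl_nonZeroDivisors R
    rw [Set.ext_iff] at this
    have := this a
    simp only [Set.mem_iUnion, SetLike.mem_coe, Set.mem_compl_iff, exists_prop] at this
    rw [← not_iff_not, ← this]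
    push Not
    rfl
  have hfin := associatedPrimes.finite R R
  let M : Set (Ideal R) := {P | Maximal (· ∈ associatedPrimes R R) P}
  have hMfin : M.Finite := hfin.subset (fun P hP => hP.1)
  have hMle : ∀ P ∈ associatedPrimes R R, ∃ Q ∈ M, P ≤ Q := by
    intro P hP
    obtain ⟨Q, hPQ, hQ⟩ := hfin.exists_le_maximal hP
    exact ⟨Q, hQ, hPQ⟩
  let A : Set (Ideal R) := {P ∈ M | s ∈ P}
  let B : Set (Ideal R) := {P ∈ M | s ∉ P}
  have hA : A.Finite := hMfin.subset (fun P hP => hP.1)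
  have hB : B.Finite := hMfin.subset (fun P hP => hP.1)
  have h1 : ∃ r ∈ sInf B, ∀ P ∈ A, r ∉ P := by
    by_contra! hc
    obtain ⟨P, hP, hle⟩ := ((sInf B).subset_union_prime_finite hA (f := id) 0 0
      fun _ h _ _ ↦ h.1.1.1).1 (by
        intro r hr
        obtain ⟨P, hP, hrP⟩ := hc r hr
        exact Set.mem_iUnion₂_of_mem hP hrP)
    have hPp : P.IsPrime := hP.1.1.1
    have : ∃ Q ∈ B, Q ≤ P := by
      rw [sInf_eq_iInf] at hle
      have h2 : hB.toFinset.inf id ≤ P := by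
        refine le_trans ?_ hle
        refine le_iInf₂ fun Q hQ => Finset.inf_le (f := id) (hB.mem_toFinset.mpr hQ)
      obtain ⟨Q, hQ, hQP⟩ := (hPp.inf_le').mp h2
      exact ⟨Q, hB.mem_toFinset.mp hQ, hQP⟩
    obtain ⟨Q, hQ, hQP⟩ := this
    have : P ≤ Q := hQ.1.2 hP.1.1 hQP
    exact hQ.2 (this hP.2)
  obtain ⟨r, hr, hrA⟩ := h1
  refine ⟨r, (hnzd _).mpr fun P hP hmem => ?_⟩
  obtain ⟨Q, hQ, hPQ⟩ := hMle P hP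
  have hmemQ := hPQ hmem
  have hQp : Q.IsPrime := hQ.1.1
  by_cases hs : s ∈ Q
  · have h2 : y * r ∈ Q := by simpa using Q.sub_mem hmemQ hs
    rcases hQp.mem_or_mem h2 with h | h
    · exact (hnzd y).mp hy Q hQ.1 h
    · exact hrA Q ⟨hQ, hs⟩ h
  · have h2 : r ∈ Q := (Ideal.mem_sInf.mp hr) ⟨hQ, hs⟩
    exact hs (by simpa using Q.sub_mem hmemQ (Q.mul_mem_left y h2))

lemma colon_regular {R : Type*} [CommRing R] (p : ℕ)
    [ExpChar R p] (hinf : InfComm R p) (e : ℕ) (X : Ideal R) (s b : R)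
    (hs : s ∈ nonZeroDivisors R) (hb : b * s ^ p ^ e ∈ X.map (iterateFrobenius R p e)) :
    b ∈ (X.colon {s}).map (iterateFrobenius R p e) := by
  have h1 : b * s ^ p ^ e ∈ (sInf {X, Ideal.span {s}}).map (iterateFrobenius R p e) := by
    apply hinf
    rintro L (rfl | rfl)
    · exact hb
    · rw [map_span_sing]; exact Ideal.mul_mem_left _ _ (Ideal.mem_span_singleton_self _)
  have h2 : sInf {X, Ideal.span {s}} ≤ Ideal.span {s} * X.colon {s} := by
    rw [sInf_pair]
    rintro w ⟨hw1, hw2⟩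
    obtain ⟨c, rfl⟩ := Ideal.mem_span_singleton'.mp hw2
    rw [mul_comm c s]
    exact Ideal.mul_mem_mul (Ideal.mem_span_singleton_self s) (by
      rw [Submodule.mem_colon_singleton]; exact hw1)
  have h3 := Ideal.map_mono h2 h1
  rw [Ideal.map_mul, map_span_sing, Ideal.mem_span_singleton_mul] at h3
  obtain ⟨z, hz, hzb⟩ := h3
  have : b = z := by
    have hq : s ^ p ^ e ∈ nonZeroDivisors R := pow_mem hs _
    apply (mul_cancel_right_mem_nonZeroDivisors hq).mp
    rw [← hzb, mul_comm]
  rwa [this]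

lemma colon_of_regular_mem {R : Type*} [CommRing R] [IsNoetherianRing R] (p : ℕ) (hp : p.Prime)
    [ExpChar R p] (hinf : InfComm R p) (e : ℕ) (X : Ideal R) (s b y : R) (hyX : y ∈ X)
    (hy : y ∈ nonZeroDivisors R) (hb : b * s ^ p ^ e ∈ X.map (iterateFrobenius R p e)) :
    b ∈ (X.colon {s}).map (iterateFrobenius R p e) := by
  obtain ⟨r, hr⟩ := exists_regular_add y s hy
  have hyr : y * r ∈ X := X.mul_mem_right _ hyX
  have h1 := colon_regular p hinf e X (s + y * r) b hr (by
    rw [add_pow_expChar_pow, mul_add]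
    exact Ideal.add_mem _ hb (Ideal.mul_mem_left _ _ (Ideal.mem_map_of_mem (iterateFrobenius R p e) hyr)))
  refine Ideal.map_mono ?_ h1
  intro c hc
  rw [Submodule.mem_colon_singleton, smul_eq_mul] at hc ⊢
  have := X.sub_mem hc (X.mul_mem_left c hyr)
  convert this using 1; ring

lemma colon_of_W {R : Type*} [CommRing R] [IsNoetherianRing R] (p : ℕ) (hp : p.Prime)
    [ExpChar R p] (hinf : InfComm R p) (W : Ideal R)
    (hW : ∀ m : Ideal R, m.IsMaximal → (¬ ∃ y ∈ m, y ∈ nonZeroDivisors R) → ∃ t ∈ W, t ∉ m)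
    (e : ℕ) (X : Ideal R) (hX : W ≤ X) (s b : R)
    (hb : b * s ^ p ^ e ∈ X.map (iterateFrobenius R p e)) :
    b ∈ (X.colon {s}).map (iterateFrobenius R p e) := by
  have h1 : b ∈ (sInf {L | ∃ (m : Ideal R) (n : ℕ), m.IsMaximal ∧ L = (X ⊔ m ^ n).colon {s}}).map
      (iterateFrobenius R p e) := by
    apply hinf
    rintro L ⟨m, n, hm, rfl⟩
    by_cases hy : ∃ y ∈ m, y ∈ nonZeroDivisors R
    · obtain ⟨y, hym, hy⟩ := hy
      exact colon_of_regular_mem p hp hinf e _ s b (y ^ n)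
        (Ideal.mem_sup_right (Ideal.pow_mem_pow hym n)) (pow_mem hy n)
        (Ideal.map_mono le_sup_left hb)
    · obtain ⟨t, htW, htm⟩ := hW m hm hy
      have htop : X ⊔ m ^ n = ⊤ := by
        by_contra hne
        obtain ⟨m', hm', hle⟩ := Ideal.exists_le_maximal _ hne
        have : m ≤ m' := fun a ha => hm'.isPrime.mem_of_pow_mem n
          (hle (Ideal.mem_sup_right (Ideal.pow_mem_pow ha n)))
        have := hm.eq_of_le hm'.ne_top this
        exact htm (this ▸ hle (Ideal.mem_sup_left (hX htW)))
      have : (X ⊔ m ^ n).colon {s} = ⊤ := by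
        rw [htop, Ideal.eq_top_iff_one, Submodule.mem_colon_singleton]; trivial
      rw [this, Ideal.map_top]; trivial
  refine Ideal.map_mono ?_ h1
  intro c hc
  rw [Submodule.mem_colon_singleton, smul_eq_mul]
  apply krull_all
  intro m hm n
  have := Ideal.mem_sInf.mp hc ⟨m, n, hm, rfl⟩
  rwa [Submodule.mem_colon_singleton, smul_eq_mul] at this

lemma artinian_of_killed {R M : Type*} [CommRing R] [AddCommGroup M] [Module R M]
    [Module.Finite R M] (c : Ideal R) [IsArtinianRing (R ⧸ c)]
    (h : ∀ a ∈ c, ∀ x : M, a • x = 0) : IsArtinian R M := by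
  let _ : Module (R ⧸ c) M := Module.IsTorsionBySet.module (I := c) (fun x a => h a.1 a.2 x)
  have : IsScalarTower R (R ⧸ c) M := Module.IsTorsionBySet.isScalarTower _
  have : Module.Finite (R ⧸ c) M := Module.Finite.of_restrictScalars_finite R (R ⧸ c) M
  exact isArtinian_of_surjective_algebraMap (R := R ⧸ c) Ideal.Quotient.mk_surjective

lemma artinian_quot_pow {R : Type*} [CommRing R] [IsNoetherianRing R] (m : Ideal R)
    (hm : m.IsMaximal) (n : ℕ) : IsArtinianRing (R ⧸ m ^ n) := by
  rw [isArtinianRing_iff_krullDimLE_zero, Ring.krullDimLE_zero_iff]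
  intro J hJ
  have hle : m ≤ J.comap (Ideal.Quotient.mk (m ^ n)) := by
    intro a ha
    have hJ' := hJ.comap (Ideal.Quotient.mk (m ^ n))
    apply hJ'.mem_of_pow_mem n
    rw [Ideal.mem_comap, Ideal.Quotient.eq_zero_iff_mem.mpr (Ideal.pow_mem_pow ha n)]
    exact J.zero_mem
  have hJ' := hJ.comap (Ideal.Quotient.mk (m ^ n))
  have heq := hm.eq_of_le hJ'.ne_top hle
  have : (J.comap (Ideal.Quotient.mk (m ^ n))).IsMaximal := heq ▸ hm
  exact Ideal.isMaximal_of_isIntegral_of_isMaximal_comap _ this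

lemma exists_max_ideal {R : Type*} [CommRing R] [IsNoetherianRing R] (Q : Ideal R → Prop)
    (h : ∃ V, Q V) : ∃ W : Ideal R, Q W ∧ ∀ V, Q V → ¬ W < V :=
  set_has_maximal_iff_noetherian.mpr (inferInstance : IsNoetherian R R) {V | Q V} h

lemma exists_W {R : Type*} [CommRing R] [IsNoetherianRing R] (p : ℕ) (hp : p.Prime)
    [ExpChar R p] (hinf : InfComm R p) :
    ∃ W : Ideal R, IsArtinian R W ∧ (∀ e : ℕ, W ≤ W.map (iterateFrobenius R p e)) ∧
      (∀ m : Ideal R, m.IsMaximal → (¬ ∃ y ∈ m, y ∈ nonZeroDivisors R) → ∃ t ∈ W, t ∉ m) := by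
  obtain ⟨W, hW, hmax⟩ := exists_max_ideal (fun V : Ideal R => IsArtinian R V)
    ⟨⊥, isArtinian_of_finite⟩
  have hle : ∀ V : Ideal R, IsArtinian R V → V ≤ W := by
    intro V hV
    have h1 : IsArtinian R ↥(W ⊔ V) := isArtinian_sup W V
    have h2 := hmax (W ⊔ V) h1
    by_contra hc
    exact h2 (lt_of_le_of_ne le_sup_left (fun h => hc (h ▸ le_sup_right)))
  have hbad : ∀ m : Ideal R, m.IsMaximal → (¬ ∃ y ∈ m, y ∈ nonZeroDivisors R) →
      ∃ t ∈ W, t ∉ m := by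
    intro m hm hy
    obtain ⟨t, ht, n, hn⟩ := (dichotomy p hp hinf m hm).resolve_left hy
    refine ⟨t, ?_, ht⟩
    have := artinian_quot_pow m hm n
    have h1 : IsArtinian R (Ideal.span {t}) := by
      apply artinian_of_killed (m ^ n)
      rintro a ha ⟨x, hx⟩
      obtain ⟨c, rfl⟩ := Ideal.mem_span_singleton'.mp hx
      ext
      simp only [SetLike.val_smul, smul_eq_mul, ZeroMemClass.coe_zero]
      linear_combination c * hn a ha
    exact hle _ h1 (Ideal.mem_span_singleton_self t)
  refine ⟨W, hW, ?_, hbad⟩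
  intro e w hw
  by_contra hc
  have hne : (W.map (iterateFrobenius R p e)).colon {w} ≠ ⊤ := by
    intro ht
    have : (1 : R) ∈ (W.map (iterateFrobenius R p e)).colon {w} := ht ▸ trivial
    rw [Submodule.mem_colon_singleton, one_smul] at this
    exact hc this
  obtain ⟨m, hm, hlem⟩ := Ideal.exists_le_maximal _ hne
  by_cases hy : ∃ y ∈ m, y ∈ nonZeroDivisors R
  · obtain ⟨y, hym, hy⟩ := hy
    have hdiv : ∀ n : ℕ, w ∈ (⊥ : Ideal R) ⊔ (Ideal.span {y}) ^ n := by
      intro n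
      have hsurj := IsArtinian.surjective_of_injective_endomorphism
        (LinearMap.lsmul R W (y ^ n)) (by
          intro a b hab
          have h2 : y ^ n * (a : R) = y ^ n * (b : R) := congrArg Subtype.val hab
          exact Subtype.ext ((mul_cancel_left_mem_nonZeroDivisors (pow_mem hy n)).mp h2))
      obtain ⟨z, hz⟩ := hsurj ⟨w, hw⟩
      have h3 : y ^ n * (z : R) = w := congrArg Subtype.val hz
      apply Ideal.mem_sup_right
      rw [Ideal.span_singleton_pow, ← h3]
      exact Ideal.mul_mem_right _ _ (Ideal.mem_span_singleton_self _)
    obtain ⟨r, hr, h0⟩ := krull_aux _ _ _ hdiv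
    have hr' : r ∈ m := (Ideal.span_singleton_le_iff_mem m).mpr hym hr
    have : 1 - r ∈ m := hlem (by
      rw [Submodule.mem_colon_singleton, smul_eq_mul, (Submodule.mem_bot R).mp h0]
      exact Ideal.zero_mem _)
    exact hm.ne_top ((Ideal.eq_top_iff_one m).mpr (by simpa using m.add_mem this hr'))
  · obtain ⟨t, htW, htm⟩ := hbad m hm hy
    apply htm
    apply hm.isPrime.mem_of_pow_mem (p ^ e)
    apply hlem
    rw [Submodule.mem_colon_singleton]
    exact Ideal.mul_mem_right _ _ (Ideal.mem_map_of_mem (iterateFrobenius R p e) htW)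

/-- A descending chain of ideals `C e` with `c * C 0 ≤ C e` and `S / c` Artinian stabilizes. -/
lemma chain_stab {S : Type*} [CommRing S] [IsNoetherianRing S] (c : Ideal S)
    [IsArtinianRing (S ⧸ c)] (C : ℕ → Ideal S) (hC : Antitone C) (h : ∀ e, c * C 0 ≤ C e) :
    ∃ n, C n = C (n + 1) := by
  let D : Submodule S (C 0) := c • ⊤
  have hart : IsArtinian S ((C 0) ⧸ D) := by
    apply artinian_of_killed c
    intro a ha x
    obtain ⟨x, rfl⟩ := Submodule.Quotient.mk_surjective _ x
    rw [← Submodule.Quotient.mk_smul, Submodule.Quotient.mk_eq_zero]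
    exact Submodule.smul_mem_smul ha trivial
  let f : ℕ →o (Submodule S ((C 0) ⧸ D))ᵒᵈ :=
    ⟨fun n => OrderDual.toDual (Submodule.map D.mkQ (Submodule.comap (C 0).subtype (C n))), fun a b hab => by
      apply OrderDual.toDual_le_toDual.mpr
      exact Submodule.map_mono (Submodule.comap_mono (hC hab))⟩
  obtain ⟨n, hn⟩ := IsArtinian.monotone_stabilizes f
  refine ⟨n, le_antisymm ?_ (hC n.le_succ)⟩
  intro x hx
  have hx0 : x ∈ C 0 := hC n.zero_le hx
  have h1 : (Submodule.comap (C 0).subtype (C n)).map D.mkQ = (Submodule.comap (C 0).subtype (C (n+1))).map D.mkQ :=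
    congrArg OrderDual.ofDual (hn (n + 1) n.le_succ)
  have h2 : D.mkQ ⟨x, hx0⟩ ∈ (Submodule.comap (C 0).subtype (C n)).map D.mkQ :=
    Submodule.mem_map_of_mem (by simpa using hx)
  rw [h1] at h2
  obtain ⟨y, hy, hyx⟩ := h2
  have h3 : (⟨x, hx0⟩ - y : C 0) ∈ D := by
    rw [← Submodule.Quotient.mk_eq_zero, Submodule.Quotient.mk_sub, sub_eq_zero]
    exact hyx.symm
  have h4 : D.map (C 0).subtype ≤ C (n + 1) := by
    rw [Submodule.map_smul'', Submodule.map_top, Submodule.range_subtype]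
    exact h (n + 1)
  have h5 : x - y ∈ C (n + 1) := h4 ⟨_, h3, rfl⟩
  have h6 : (y : S) ∈ C (n + 1) := hy
  simpa using Ideal.add_mem _ h5 h6

/-- Gabber-style Noetherian induction. -/
lemma gabber {R : Type*} [CommRing R] [IsNoetherianRing R] (A : ℕ → Ideal R) (hA : Antitone A)
    (hs : ∀ (s : R) (N : ℕ), (∀ a ∈ A N, s * a ∈ A (N + 1)) →
      ∀ e, N ≤ e → ∀ a ∈ A N, s ^ 2 * a ∈ A e) :
    ∃ N, ∀ e, N ≤ e → A e = A N := by
  obtain ⟨c, ⟨N, hN⟩, hmax⟩ := exists_max_ideal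
    (fun c : Ideal R => ∃ N, ∀ e, c * A N ≤ A e) ⟨⊥, 0, fun e => by simp⟩
  by_cases hc : c = ⊤
  · refine ⟨N, fun e he => le_antisymm (hA he) ?_⟩
    have := hN e
    rwa [hc, Ideal.top_mul] at this
  exfalso
  obtain ⟨m, hm, hcm⟩ := Ideal.exists_le_maximal c hc
  have hmp := hm.isPrime
  obtain ⟨P, hP, -⟩ := Ideal.exists_minimalPrimes_le hcm
  have hPp : P.IsPrime := hP.1.1
  let S := Localization.AtPrime P
  have hmin : IsLocalRing.maximalIdeal S ∈ (c.map (algebraMap R S)).minimalPrimes := by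
    refine ⟨⟨inferInstance, ?_⟩, ?_⟩
    · rw [← Localization.AtPrime.map_eq_maximalIdeal]
      exact Ideal.map_mono hP.1.2
    · rintro Q ⟨hQ, hcQ⟩ hQm
      have h1 : P ≤ Q.comap (algebraMap R S) := by
        apply hP.2 ⟨hQ.comap _, Ideal.map_le_iff_le_comap.mp hcQ⟩
        have := Ideal.comap_mono (f := algebraMap R S) hQm
        exact this.trans (Localization.AtPrime.under_maximalIdeal (I := P)).le
      rw [← Localization.AtPrime.map_eq_maximalIdeal]
      exact Ideal.map_le_iff_le_comap.mpr h1
  have := IsLocalRing.quotient_artinian_of_mem_minimalPrimes_of_isLocalRing _ hmin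
  obtain ⟨n, hn⟩ := chain_stab (c.map (algebraMap R S))
    (fun e => (A (N + e)).map (algebraMap R S))
    (fun a b hab => Ideal.map_mono (hA (by omega))) (fun e => by
      rw [← Ideal.map_mul]
      exact Ideal.map_mono (hN _))
  obtain ⟨s, hsP, hsA⟩ := exists_common P hPp (A (N + n)) (A (N + n + 1)) (by
    intro a ha
    have h1 := Ideal.mem_map_of_mem (algebraMap R S) ha
    have h2 : algebraMap R S a ∈ (A (N + n + 1)).map (algebraMap R S) := by
      have h3 : (A (N + n)).map (algebraMap R S) = (A (N + n + 1)).map (algebraMap R S) := hn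
      rwa [h3] at h1
    obtain ⟨t, ht, hta⟩ := (IsLocalization.algebraMap_mem_map_algebraMap_iff P.primeCompl S _ _).mp h2
    exact ⟨t, ht, hta⟩)
  have h2 := hs s (N + n) hsA
  have hgood : ∃ N, ∀ e, (c ⊔ Ideal.span {s ^ 2}) * A N ≤ A e := by
    refine ⟨N + n, fun e => ?_⟩
    rw [Ideal.sup_mul]
    refine sup_le ((Ideal.mul_mono_right (hA (by omega))).trans (hN e)) ?_
    rw [Ideal.span_singleton_mul_le_iff]
    intro a ha
    rcases le_total (N + n) e with he | he
    · exact h2 e he a ha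
    · exact Ideal.mul_mem_left _ _ (hA he ha)
  have h3 := hmax _ hgood
  apply h3
  refine lt_of_le_of_ne le_sup_left (fun h => hsP ?_)
  apply hPp.mem_of_pow_mem 2
  apply hP.1.2
  rw [h]
  exact Ideal.mem_sup_right (Ideal.mem_span_singleton_self _)

lemma nu_succ (p e : ℕ) : nu p (e + 1) = nu p e + p ^ e := Finset.sum_range_succ _ _

lemma nu_add (p a b : ℕ) : nu p (a + b) = nu p a + p ^ a * nu p b := by
  unfold nu
  rw [Finset.sum_range_add, Finset.mul_sum]
  simp_rw [pow_add]

theorem stmt_19 {R : Type*} [CommRing R] [IsNoetherianRing R] (p : ℕ) (hp : p.Prime) [CharP R p]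
    (Ie : ℕ → Ideal R → Ideal R)
    (hIe : ∀ (e : ℕ) (A : Ideal R), A ≤ fpow (p ^ e) (Ie e A))
    (hIemin : ∀ (e : ℕ) (A L : Ideal R), A ≤ fpow (p ^ e) L → Ie e A ≤ L)
    (u : R) (I J : Ideal R)
    (hI : ∀ x ∈ I, u * x ∈ fpow p I)
    (hIJ : I ≤ J)
    (hu : ∀ x ∈ J, u * x ∈ fpow p J) :
    (⨅ e : ℕ, Ie e (Ideal.span {u ^ nu p e} *
        ((⨅ e' : ℕ, Ie e' (Ideal.span {u ^ nu p e'} * J)) ⊔ I))) ⊔ I =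
      (⨅ e : ℕ, Ie e (Ideal.span {u ^ nu p e} * J)) ⊔ I := by
  have : ExpChar R p := .prime hp
  have hf : ∀ e (L : Ideal R), fpow (p ^ e) L = L.map (iterateFrobenius R p e) := fun _ _ => rfl
  have hf1 : ∀ (L : Ideal R), fpow p L = L.map (iterateFrobenius R p 1) := fun L => by
    rw [← hf, pow_one]
  have hfadd : ∀ a b (L : Ideal R), L.map (iterateFrobenius R p (a + b)) =
      (L.map (iterateFrobenius R p b)).map (iterateFrobenius R p a) := fun a b L => by
    rw [Ideal.map_map, iterateFrobenius_add]
  simp_rw [hf] at hIe hIemin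
  rw [hf1] at hI hu
  have hadj : ∀ e (A L : Ideal R), Ie e A ≤ L ↔ A ≤ L.map (iterateFrobenius R p e) :=
    fun e A L => ⟨fun h => (hIe e A).trans (Ideal.map_mono h), hIemin e A L⟩
  have hinf : InfComm R p := by
    intro e S x hx
    have h1 : Ie e (Ideal.span {x}) ≤ sInf S := le_sInf fun L hL => by
      rw [hadj, Ideal.span_singleton_le_iff_mem]; exact hx L hL
    rw [hadj, Ideal.span_singleton_le_iff_mem] at h1
    exact h1
  obtain ⟨W, hWart, hWfrob, hWbad⟩ := exists_W p hp hinf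
  have hcol := colon_of_W p hp hinf W hWbad
  set A : ℕ → Ideal R := fun e => Ie e (Ideal.span {u ^ nu p e} * J) with hAdef
  have hAle : ∀ e (L : Ideal R), A e ≤ L ↔
      ∀ x ∈ J, u ^ nu p e * x ∈ L.map (iterateFrobenius R p e) := fun e L => by
    rw [hAdef, hadj, Ideal.span_singleton_mul_le_iff]
  have hAmem : ∀ e, ∀ x ∈ J, u ^ nu p e * x ∈ (A e).map (iterateFrobenius R p e) := fun e =>
    (hAle e (A e)).mp le_rfl
  have hA : Antitone A := by
    apply antitone_nat_of_succ_le
    intro e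
    rw [hAle]
    intro x hx
    have h1 : J ≤ ((A e).map (iterateFrobenius R p e)).colon {u ^ nu p e} := fun y hy => by
      rw [Submodule.mem_colon_singleton, smul_eq_mul, mul_comm]; exact hAmem e y hy
    have h2 := Ideal.map_mono (f := iterateFrobenius R p 1) h1 (hu x hx)
    have h3 : (((A e).map (iterateFrobenius R p e)).colon {u ^ nu p e}).map
        (iterateFrobenius R p 1) ≤
        ((A e).map (iterateFrobenius R p (1 + e))).colon {(u ^ nu p e) ^ p ^ 1} := by
      rw [Ideal.map_le_iff_le_comap]
      intro y hy
      rw [Submodule.mem_colon_singleton, smul_eq_mul] at hy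
      rw [Ideal.mem_comap, Submodule.mem_colon_singleton, smul_eq_mul, iterateFrobenius_def,
        ← mul_pow, hfadd]
      exact Ideal.mem_map_of_mem (iterateFrobenius R p 1) hy
    have h4 := h3 h2
    rw [Submodule.mem_colon_singleton, smul_eq_mul, add_comm 1 e] at h4
    convert h4 using 1
    rw [add_comm e 1, nu_add, ← pow_mul]
    have : nu p 1 = 1 := by simp [nu]
    rw [this, pow_add]
    ring
  -- passing to `A e ⊔ W`
  have hrec : ∀ e (L : Ideal R), W ≤ L →
      (A (e + 1) ≤ L ↔ ∀ a ∈ A e, u * a ∈ L.map (iterateFrobenius R p 1)) := by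
    intro e L hWL
    have hWL1 : W ≤ L.map (iterateFrobenius R p 1) := (hWfrob 1).trans (Ideal.map_mono hWL)
    have h0 : (∀ a ∈ A e, u * a ∈ L.map (iterateFrobenius R p 1)) ↔
        A e ≤ (L.map (iterateFrobenius R p 1)).colon {u} := by
      refine forall₂_congr fun a _ => ?_
      rw [Submodule.mem_colon_singleton, smul_eq_mul, mul_comm]
    rw [h0, hAle, hAle]
    refine forall₂_congr fun x _ => ?_
    rw [hfadd, nu_succ, pow_add]
    constructor
    · intro h
      apply hcol e _ hWL1
      convert h using 1; ring
    · intro h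
      have h3 : ((L.map (iterateFrobenius R p 1)).colon {u}).map (iterateFrobenius R p e) ≤
          ((L.map (iterateFrobenius R p 1)).map (iterateFrobenius R p e)).colon {u ^ p ^ e} := by
        rw [Ideal.map_le_iff_le_comap]
        intro y hy
        rw [Submodule.mem_colon_singleton, smul_eq_mul] at hy
        rw [Ideal.mem_comap, Submodule.mem_colon_singleton, smul_eq_mul, iterateFrobenius_def,
          ← mul_pow]
        exact Ideal.mem_map_of_mem (iterateFrobenius R p e) hy
      have h4 := h3 h
      rw [Submodule.mem_colon_singleton, smul_eq_mul] at h4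
      convert h4 using 1; ring
  have hstab1 : ∃ N, ∀ e, N ≤ e → A e ⊔ W = A N ⊔ W := by
    apply gabber (fun e => A e ⊔ W) (fun a b hab => sup_le_sup_right (hA hab) _)
    intro s N hsN e he
    induction e, he using Nat.le_induction with
    | base => intro a ha; exact Ideal.mul_mem_left _ _ ha
    | succ e he ih =>
      intro a ha
      have hWL : W ≤ A (e + 1) ⊔ W := le_sup_right
      have hWL1 : W ≤ (A (e + 1) ⊔ W).map (iterateFrobenius R p 1) :=
        (hWfrob 1).trans (Ideal.map_mono hWL)
      have key := (hrec e _ hWL).mp le_sup_left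
      have h1 : A (N + 1) ≤ (A (e + 1) ⊔ W).colon {s} := by
        rw [hrec N _ (hWL.trans Ideal.le_colon)]
        intro b hb
        apply hcol 1 _ hWL
        have h2 : s ^ p ^ 1 * b ∈ A e ⊔ W := by
          obtain ⟨k, hk⟩ := Nat.exists_eq_add_of_le hp.two_le
          rw [pow_one, hk, pow_add, mul_right_comm]
          exact Ideal.mul_mem_right _ _ (ih b (Ideal.mem_sup_left hb))
        obtain ⟨x, hx, w, hw, hxw⟩ := Submodule.mem_sup.mp h2
        have h3 : u * b * s ^ p ^ 1 = u * x + u * w := by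
          rw [← mul_add, hxw]; ring
        rw [h3]
        exact Ideal.add_mem _ (key x hx) (Ideal.mul_mem_left _ _ (hWL1 hw))
      have h4 : A (N + 1) ⊔ W ≤ (A (e + 1) ⊔ W).colon {s} := sup_le h1 (hWL.trans Ideal.le_colon)
      have h5 := h4 (hsN a ha)
      rw [Submodule.mem_colon_singleton, smul_eq_mul] at h5
      convert h5 using 1; ring
  have hstab2 : ∃ N, ∀ e, N ≤ e → A e ⊓ W = A N ⊓ W := by
    let f : ℕ →o (Submodule R W)ᵒᵈ :=
      ⟨fun n => OrderDual.toDual (Submodule.comap W.subtype (A n)), fun a b hab => by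
        apply OrderDual.toDual_le_toDual.mpr
        exact Submodule.comap_mono (hA hab)⟩
    obtain ⟨N, hN⟩ := IsArtinian.monotone_stabilizes f
    refine ⟨N, fun e he => ?_⟩
    have h1 : Submodule.comap W.subtype (A N) = Submodule.comap W.subtype (A e) := congrArg OrderDual.ofDual (hN e he)
    ext x
    constructor
    · rintro ⟨h2, h3⟩
      have : (⟨x, h3⟩ : W) ∈ Submodule.comap W.subtype (A e) := h2
      rw [← h1] at this
      exact ⟨this, h3⟩
    · rintro ⟨h2, h3⟩
      have : (⟨x, h3⟩ : W) ∈ Submodule.comap W.subtype (A N) := h2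
      rw [h1] at this
      exact ⟨this, h3⟩
  obtain ⟨N1, hN1⟩ := hstab1
  obtain ⟨N2, hN2⟩ := hstab2
  have hstab : ∃ N, ∀ e, A N ≤ A e := by
    refine ⟨max N1 N2, fun e => ?_⟩
    rcases le_total e (max N1 N2) with he | he
    · exact hA he
    · have h1 : A e ⊔ W = A (max N1 N2) ⊔ W :=
        (hN1 e (by omega)).trans (hN1 _ (by omega)).symm
      have h2 : A e ⊓ W = A (max N1 N2) ⊓ W :=
        (hN2 e (by omega)).trans (hN2 _ (by omega)).symm
      exact (eq_of_le_of_inf_le_of_sup_le (hA he) h2.ge h1.ge).ge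
  obtain ⟨N, hN⟩ := hstab
  have hK : (⨅ e, A e) = A N := le_antisymm (iInf_le _ _) (le_iInf hN)
  have hA0 : A 0 ≤ J := by
    rw [hAle]
    intro x hx
    rw [iterateFrobenius_zero, Ideal.map_id]
    exact Ideal.mul_mem_left _ _ hx
  change _ = (⨅ e, A e) ⊔ I
  change (⨅ e : ℕ, Ie e (Ideal.span {u ^ nu p e} * ((⨅ e', A e') ⊔ I))) ⊔ I = _
  apply le_antisymm
  · refine sup_le_sup_right (iInf_mono fun e => ?_) I
    rw [hadj]
    refine le_trans ?_ (hIe e (Ideal.span {u ^ nu p e} * J))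
    exact Ideal.mul_mono_right (sup_le ((iInf_le _ 0).trans hA0) hIJ)
  · refine sup_le_sup_right (le_iInf fun e => ?_) I
    rw [hK]
    refine (hN (N + e)).trans ?_
    set L := Ie e (Ideal.span {u ^ nu p e} * (A N ⊔ I)) with hL
    have h1 : Ideal.span {u ^ nu p e} * (A N ⊔ I) ≤ L.map (iterateFrobenius R p e) := hIe _ _
    have h2 : A N ≤ (L.map (iterateFrobenius R p e)).colon {u ^ nu p e} := fun a ha => by
      rw [Submodule.mem_colon_singleton, smul_eq_mul, mul_comm]
      exact h1 (Ideal.mul_mem_mul (Ideal.mem_span_singleton_self _) (Ideal.mem_sup_left ha))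
    rw [hAle]
    intro x hx
    have h3 : ((L.map (iterateFrobenius R p e)).colon {u ^ nu p e}).map (iterateFrobenius R p N) ≤
        (L.map (iterateFrobenius R p (N + e))).colon {(u ^ nu p e) ^ p ^ N} := by
      rw [Ideal.map_le_iff_le_comap]
      intro y hy
      rw [Submodule.mem_colon_singleton, smul_eq_mul] at hy
      rw [Ideal.mem_comap, Submodule.mem_colon_singleton, smul_eq_mul, iterateFrobenius_def,
        ← mul_pow, hfadd]
      exact Ideal.mem_map_of_mem (iterateFrobenius R p N) hy
    have h4 := h3 (Ideal.map_mono h2 (hAmem N x hx))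
    rw [Submodule.mem_colon_singleton, smul_eq_mul] at h4
    convert h4 using 1
    rw [nu_add, ← pow_mul, pow_add, mul_comm (p ^ N)]
    ring
end
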